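/- arXiv:2210.11734 — 2 statements merged into one kernel-verified Lean document; each statement's English description precedes it below -/
import Mathlib

section
/- Let n ≥ 2 and let Ω ⊂ ℝⁿ be a bounded set of finite perimeter. There exists a constant C(n) > 0 depending only on n such that for every ε ∈ (0,1) there exist finitely or countably many open balls B_j, each with radius less than ε and centered at a point of ∂Ω ∩ Ω⁰, whose union covers ∂Ω ∩ Ω⁰, and such that P(∪_j B_j; Ω¹) ≤ C(n)·ε, where P(∪_j B_j; Ω¹) denotes H^{n−1}(∂*(∪_j B_j) ∩ Ω¹), and Σ_j |B_j ∩ Ω| ≤ C(n)·ε². -/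
open MeasureTheory Metric Filter Set
open scoped ENNReal Topology NNReal

noncomputable section

/-- The divergence of a vector field `φ : ℝⁿ → ℝⁿ`. -/
def vdiv {n : ℕ} (φ : EuclideanSpace ℝ (Fin n) → EuclideanSpace ℝ (Fin n))
    (x : EuclideanSpace ℝ (Fin n)) : ℝ :=
  ∑ i, fderiv ℝ φ x (EuclideanSpace.single i 1) i

/-- The relative perimeter `P(E; W)` of a set `E` in an open set `W`, defined variationally as
`sup { ∫_E div φ : φ ∈ C¹_c(W; ℝⁿ), ‖φ‖_∞ ≤ 1 }`. -/
def relPerimeter {n : ℕ} (E W : Set (EuclideanSpace ℝ (Fin n))) : ℝ≥0∞ :=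
  ⨆ (φ : EuclideanSpace ℝ (Fin n) → EuclideanSpace ℝ (Fin n)) (_ : ContDiff ℝ 1 φ)
    (_ : HasCompactSupport φ) (_ : tsupport φ ⊆ W) (_ : ∀ x, ‖φ x‖ ≤ 1),
    ENNReal.ofReal (∫ x in E, vdiv φ x)

/-- The perimeter `P(E)` of a set `E ⊆ ℝⁿ`:
`P(E) = sup { ∫_E div φ : φ ∈ C¹_c(ℝⁿ; ℝⁿ), ‖φ‖_∞ ≤ 1 }`. -/
def perimeter {n : ℕ} (E : Set (EuclideanSpace ℝ (Fin n))) : ℝ≥0∞ :=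
  relPerimeter E Set.univ

/-- The set of points where `Ω` has Lebesgue density `α`; `densityPts Ω 1` is the
measure-theoretic interior `Ω¹` and `densityPts Ω 0` is the measure-theoretic exterior `Ω⁰`. -/
def densityPts {n : ℕ} (Ω : Set (EuclideanSpace ℝ (Fin n))) (α : ℝ≥0∞) :
    Set (EuclideanSpace ℝ (Fin n)) :=
  {x | Tendsto (fun r : ℝ => volume (Ω ∩ ball x r) / volume (ball x r)) (𝓝[>] 0) (𝓝 α)}

/-- A smooth set: a bounded open set whose topological boundary is a smooth hypersurface,
expressed via a smooth defining function with nonvanishing differential on the boundary. -/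
def IsSmoothSet {n : ℕ} (E : Set (EuclideanSpace ℝ (Fin n))) : Prop :=
  IsOpen E ∧ Bornology.IsBounded E ∧
  ∃ f : EuclideanSpace ℝ (Fin n) → ℝ, ContDiff ℝ (⊤ : ℕ∞) f ∧
    E = {x | f x < 0} ∧ frontier E = {x | f x = 0} ∧
    ∀ x ∈ frontier E, fderiv ℝ f x ≠ 0

/-- `E ⋐ Ω` : the closure of `E` is compact and contained in `Ω`. -/
def CpctContained {n : ℕ} (E Ω : Set (EuclideanSpace ℝ (Fin n))) : Prop :=
  IsCompact (closure E) ∧ closure E ⊆ Ω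

/-- `E_k → Ω` in `L¹`, i.e. `|E_k Δ Ω| → 0`. -/
def TendstoL1 {n : ℕ} (E : ℕ → Set (EuclideanSpace ℝ (Fin n)))
    (Ω : Set (EuclideanSpace ℝ (Fin n))) : Prop :=
  Tendsto (fun k => volume ((E k \ Ω) ∪ (Ω \ E k))) atTop (𝓝 0)

/-- The volume `ω_n` of the unit ball in ℝⁿ. -/
def unitBallVol (n : ℕ) : ℝ≥0∞ := volume (ball (0 : EuclideanSpace ℝ (Fin n)) 1)

/-- The measure-theoretic (essential) boundary of `E`, which for a set of finite perimeter is
`H^{n-1}`-equivalent to the reduced boundary `∂*E` by Federer's theorem. -/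
def essBoundary {n : ℕ} (E : Set (EuclideanSpace ℝ (Fin n))) :
    Set (EuclideanSpace ℝ (Fin n)) :=
  Set.univ \ (densityPts E 0 ∪ densityPts E 1)

/-- Eilenberg's inequality for the distance function to a point. -/
theorem eilenberg_sphere (n : ℕ) (hn : 2 ≤ n) :
    ∃ K : ℝ≥0, ∀ (x : EuclideanSpace ℝ (Fin n)) (A : Set (EuclideanSpace ℝ (Fin n))),
      ∫⁻ r : ℝ, μH[(n : ℝ) - 1] (sphere x r ∩ A) ≤ K * volume A := by
  have hcv := Measure.isAddLeftInvariant_eq_smul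
    (μH[(Module.finrank ℝ (EuclideanSpace ℝ (Fin n)) : ℝ)] : Measure (EuclideanSpace ℝ (Fin n)))
    volume
  set c := Measure.addHaarScalarFactor
    (μH[(Module.finrank ℝ (EuclideanSpace ℝ (Fin n)) : ℝ)] : Measure (EuclideanSpace ℝ (Fin n)))
    volume
  rw [finrank_euclideanSpace_fin] at hcv
  have hd : (0 : ℝ) < (n : ℝ) - 1 := by
    have : (2 : ℝ) ≤ n := by exact_mod_cast hn
    linarith
  have main : ∀ (x : EuclideanSpace ℝ (Fin n)) (A : Set (EuclideanSpace ℝ (Fin n))),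
      ∫⁻ r : ℝ, μH[(n : ℝ) - 1] (sphere x r ∩ A) ≤ 2 * μH[(n : ℝ)] A := by
    intro x A
    by_cases hA : μH[(n : ℝ)] A = ⊤
    · rw [hA]; simp
    have hcov : ∀ k : ℕ, ∃ t : ℕ → Set (EuclideanSpace ℝ (Fin n)), A ⊆ ⋃ i, t i ∧
        (∀ i, ediam (t i) ≤ ((k : ℝ≥0∞) + 1)⁻¹) ∧
        ∑' i, (⨆ _ : (t i).Nonempty, ediam (t i) ^ (n : ℝ)) ≤
          μH[(n : ℝ)] A + ((k : ℝ≥0∞) + 1)⁻¹ := by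
      intro k
      have hk : (0 : ℝ≥0∞) < ((k : ℝ≥0∞) + 1)⁻¹ := by
        rw [ENNReal.inv_pos]; exact ENNReal.add_ne_top.2 ⟨by simp, by simp⟩
      have h1 := Measure.hausdorffMeasure_apply (n : ℝ) A
      have h2 : (⨅ (t : ℕ → Set (EuclideanSpace ℝ (Fin n))) (_ : A ⊆ ⋃ n, t n)
          (_ : ∀ n, ediam (t n) ≤ ((k : ℝ≥0∞) + 1)⁻¹),
          ∑' i, ⨆ _ : (t i).Nonempty, ediam (t i) ^ (n : ℝ)) <
          μH[(n : ℝ)] A + ((k : ℝ≥0∞) + 1)⁻¹ := by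
        refine lt_of_le_of_lt ?_ (ENNReal.lt_add_right hA hk.ne')
        rw [h1]
        exact le_iSup₂_of_le _ hk le_rfl
      simp only [iInf_lt_iff] at h2
      obtain ⟨t, ht1, ht2, ht3⟩ := h2
      exact ⟨t, ht1, ht2, ht3.le⟩
    choose t ht1 ht2 ht3 using hcov
    have hI : ∀ k i, ∃ I : Set ℝ, MeasurableSet I ∧
        (∀ y ∈ t k i, dist y x ∈ I) ∧ ediam (t k i) ^ ((n : ℝ) - 1) * volume I ≤
          2 * (⨆ _ : (t k i).Nonempty, ediam (t k i) ^ (n : ℝ)) := by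
      intro k i
      rcases (t k i).eq_empty_or_nonempty with h | ⟨p, hp⟩
      · exact ⟨∅, MeasurableSet.empty, by simp [h], by simp⟩
      have hfin : ediam (t k i) ≠ ⊤ := by
        refine ne_top_of_le_ne_top ?_ (ht2 k i)
        simp
      refine ⟨closedBall (dist p x) (ediam (t k i)).toReal, measurableSet_closedBall, ?_, ?_⟩
      · intro y hy
        rw [mem_closedBall, Real.dist_eq]
        refine (abs_dist_sub_le y p x).trans ?_
        have := edist_le_ediam_of_mem hy hp
        rw [edist_dist] at this
        exact (ENNReal.ofReal_le_iff_le_toReal hfin).1 this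
      · rw [Real.volume_closedBall, ENNReal.ofReal_mul (by norm_num), ENNReal.ofReal_toReal hfin,
          ciSup_pos ⟨p, hp⟩]
        have : ediam (t k i) ^ (n : ℝ) = ediam (t k i) ^ ((n : ℝ) - 1) * ediam (t k i) := by
          conv_rhs => rw [← ENNReal.rpow_one (ediam (t k i)), ← ENNReal.rpow_mul, one_mul]
          rw [← ENNReal.rpow_add_of_nonneg _ _ hd.le zero_le_one]
          congr 1; ring
        rw [this]
        apply le_of_eq
        simp
        ring
    choose I hIm hImem hIv using hI
    have hlim : Tendsto (fun k : ℕ => ((k : ℝ≥0∞) + 1)⁻¹) atTop (𝓝 0) := by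
      have := (tendsto_add_atTop_iff_nat 1).2 ENNReal.tendsto_inv_nat_nhds_zero
      simpa using this
    calc ∫⁻ r : ℝ, μH[(n : ℝ) - 1] (sphere x r ∩ A)
        ≤ ∫⁻ r : ℝ, liminf (fun k => ∑' i, (I k i).indicator
            (fun _ => ediam (t k i) ^ ((n : ℝ) - 1)) r) atTop := by
          refine lintegral_mono fun r => ?_
          refine (Measure.hausdorffMeasure_le_liminf_tsum ((n : ℝ) - 1) (sphere x r ∩ A)
            (fun k : ℕ => ((k : ℝ≥0∞) + 1)⁻¹) hlim (fun k i => t k i ∩ sphere x r)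
            (Eventually.of_forall fun k i => (ediam_mono inter_subset_left).trans (ht2 k i))
            (Eventually.of_forall fun k => ?_)).trans ?_
          · rintro y ⟨hy1, hy2⟩
            obtain ⟨i, hi⟩ := mem_iUnion.1 (ht1 k hy2)
            exact mem_iUnion.2 ⟨i, hi, hy1⟩
          · refine liminf_le_liminf (Eventually.of_forall fun k => ?_)
            refine ENNReal.tsum_le_tsum fun i => ?_
            rcases (t k i ∩ sphere x r).eq_empty_or_nonempty with h | ⟨y, hy1, hy2⟩
            · simp only [h, ediam_empty]
              rw [ENNReal.zero_rpow_of_pos hd]; exact zero_le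
            · have : r ∈ I k i := by
                have := hImem k i y hy1
                rwa [mem_sphere.1 hy2] at this
              rw [indicator_of_mem this]
              exact ENNReal.rpow_le_rpow (ediam_mono inter_subset_left) hd.le
      _ ≤ liminf (fun k => ∫⁻ r : ℝ, ∑' i, (I k i).indicator
            (fun _ => ediam (t k i) ^ ((n : ℝ) - 1)) r) atTop := by
          refine lintegral_liminf_le fun k => ?_
          exact Measurable.tsum fun i => measurable_const.indicator (hIm k i)
      _ ≤ liminf (fun k : ℕ => 2 * (μH[(n : ℝ)] A + ((k : ℝ≥0∞) + 1)⁻¹)) atTop := by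
          refine liminf_le_liminf (Eventually.of_forall fun k => ?_)
          rw [lintegral_tsum fun i => (measurable_const.indicator (hIm k i)).aemeasurable]
          calc _ = ∑' i, ediam (t k i) ^ ((n : ℝ) - 1) * volume (I k i) := by
                congr 1; ext i
                rw [lintegral_indicator_const (hIm k i)]
            _ ≤ ∑' i, 2 * (⨆ _ : (t k i).Nonempty, ediam (t k i) ^ (n : ℝ)) :=
                ENNReal.tsum_le_tsum fun i => hIv k i
            _ ≤ _ := by
                rw [ENNReal.tsum_mul_left]
                gcongr
                exact ht3 k
      _ = 2 * μH[(n : ℝ)] A := by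
          apply Tendsto.liminf_eq
          have : Tendsto (fun k : ℕ => μH[(n : ℝ)] A + ((k : ℝ≥0∞) + 1)⁻¹) atTop
              (𝓝 (μH[(n : ℝ)] A + 0)) := tendsto_const_nhds.add hlim
          rw [add_zero] at this
          exact ENNReal.Tendsto.const_mul this (Or.inr (by simp))
  refine ⟨2 * c, fun x A => (main x A).trans ?_⟩
  have h2 : μH[(n : ℝ)] A = (c : ℝ≥0∞) * volume A := by
    conv_lhs => rw [hcv]
    rfl
  rw [h2, ENNReal.coe_mul, mul_assoc]
  rfl

theorem ae_densityPts {n : ℕ} (hn : 2 ≤ n) {Ω : Set (EuclideanSpace ℝ (Fin n))}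
    (hΩ : MeasurableSet Ω) :
    ∀ᵐ x, x ∈ densityPts Ω (Ω.indicator 1 x) := by
  have : Nonempty (Fin n) := ⟨⟨0, by omega⟩⟩
  filter_upwards [Besicovitch.ae_tendsto_measure_inter_div_of_measurableSet volume hΩ] with x hx
  refine hx.congr' ?_
  filter_upwards with r
  have h1 : (ball x r : Set (EuclideanSpace ℝ (Fin n))) =ᵐ[volume] closedBall x r := by
    refine (ball_subset_closedBall).eventuallyLE.antisymm ?_
    rw [ae_le_set, closedBall_sdiff_ball]
    exact Measure.addHaar_sphere _ _ _
  rw [measure_congr h1, measure_congr ((ae_eq_refl Ω).inter h1)]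

theorem volume_density_one_diff {n : ℕ} (hn : 2 ≤ n) {Ω : Set (EuclideanSpace ℝ (Fin n))}
    (hΩ : MeasurableSet Ω) : volume (densityPts Ω 1 \ Ω) = 0 := by
  rw [measure_eq_zero_iff_ae_notMem]
  filter_upwards [ae_densityPts hn hΩ] with x hx hx2
  rw [indicator_of_notMem hx2.2] at hx
  have := tendsto_nhds_unique hx hx2.1
  simp at this

theorem volume_density_zero_inter {n : ℕ} (hn : 2 ≤ n) {Ω : Set (EuclideanSpace ℝ (Fin n))}
    (hΩ : MeasurableSet Ω) : volume (densityPts Ω 0 ∩ Ω) = 0 := by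
  rw [measure_eq_zero_iff_ae_notMem]
  filter_upwards [ae_densityPts hn hΩ] with x hx hx2
  rw [indicator_of_mem hx2.2] at hx
  have := tendsto_nhds_unique hx hx2.1
  simp at this

theorem vdiv_add {n : ℕ} {φ ψ : EuclideanSpace ℝ (Fin n) → EuclideanSpace ℝ (Fin n)}
    (hφ : ContDiff ℝ 1 φ) (hψ : ContDiff ℝ 1 ψ) (x : EuclideanSpace ℝ (Fin n)) :
    vdiv (φ + ψ) x = vdiv φ x + vdiv ψ x := by
  unfold vdiv
  rw [fderiv_add (hφ.differentiable one_ne_zero x) (hψ.differentiable one_ne_zero x),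
    ← Finset.sum_add_distrib]
  rfl

theorem continuous_vdiv {n : ℕ} {φ : EuclideanSpace ℝ (Fin n) → EuclideanSpace ℝ (Fin n)}
    (hφ : ContDiff ℝ 1 φ) : Continuous (vdiv φ) := by
  have := hφ.continuous_fderiv one_ne_zero
  unfold vdiv
  fun_prop

theorem integrable_vdiv {n : ℕ} {φ : EuclideanSpace ℝ (Fin n) → EuclideanSpace ℝ (Fin n)}
    (hφ : ContDiff ℝ 1 φ) (hc : HasCompactSupport φ) : Integrable (vdiv φ) := by
  refine (continuous_vdiv hφ).integrable_of_hasCompactSupport ?_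
  refine (hc.fderiv (𝕜 := ℝ)).mono ?_
  intro x hx h
  apply hx
  simp [vdiv, h]

theorem relPerimeter_mono {n : ℕ} (E : Set (EuclideanSpace ℝ (Fin n)))
    {A B : Set (EuclideanSpace ℝ (Fin n))} (h : A ⊆ B) : relPerimeter E A ≤ relPerimeter E B := by
  unfold relPerimeter
  refine iSup_mono fun φ => iSup_mono fun h1 => iSup_mono fun h2 => ?_
  refine iSup_le fun h3 => iSup_le fun h4 => ?_
  exact le_iSup₂_of_le (h3.trans h) h4 le_rfl

theorem le_relPerimeter {n : ℕ} (E : Set (EuclideanSpace ℝ (Fin n)))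
    {A : Set (EuclideanSpace ℝ (Fin n))}
    {φ : EuclideanSpace ℝ (Fin n) → EuclideanSpace ℝ (Fin n)}
    (hφ : ContDiff ℝ 1 φ) (hc : HasCompactSupport φ) (hA : tsupport φ ⊆ A)
    (h1 : ∀ x, ‖φ x‖ ≤ 1) : ENNReal.ofReal (∫ x in E, vdiv φ x) ≤ relPerimeter E A := by
  unfold relPerimeter
  exact le_iSup_of_le φ (le_iSup_of_le hφ (le_iSup_of_le hc (le_iSup_of_le hA
    (le_iSup_of_le h1 le_rfl))))

theorem relPerimeter_add_le {n : ℕ} (E : Set (EuclideanSpace ℝ (Fin n)))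
    {A B : Set (EuclideanSpace ℝ (Fin n))} (hAB : Disjoint A B) :
    relPerimeter E A + relPerimeter E B ≤ relPerimeter E (A ∪ B) := by
  have key : ∀ φ ψ : EuclideanSpace ℝ (Fin n) → EuclideanSpace ℝ (Fin n),
      ContDiff ℝ 1 φ → HasCompactSupport φ → tsupport φ ⊆ A → (∀ x, ‖φ x‖ ≤ 1) →
      ContDiff ℝ 1 ψ → HasCompactSupport ψ → tsupport ψ ⊆ B → (∀ x, ‖ψ x‖ ≤ 1) →
      ENNReal.ofReal (∫ x in E, vdiv φ x) + ENNReal.ofReal (∫ x in E, vdiv ψ x) ≤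
        relPerimeter E (A ∪ B) := by
    intro φ ψ h1 h2 h3 h4 k1 k2 k3 k4
    rcases le_total (∫ x in E, vdiv φ x) 0 with hneg | hpos
    · rw [ENNReal.ofReal_of_nonpos hneg, zero_add]
      exact le_relPerimeter E k1 k2 (k3.trans subset_union_right) k4
    rcases le_total (∫ x in E, vdiv ψ x) 0 with hneg' | hpos'
    · rw [ENNReal.ofReal_of_nonpos hneg', add_zero]
      exact le_relPerimeter E h1 h2 (h3.trans subset_union_left) h4
    rw [← ENNReal.ofReal_add hpos hpos', ← integral_add (integrable_vdiv h1 h2).integrableOn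
      (integrable_vdiv k1 k2).integrableOn]
    simp_rw [← vdiv_add h1 k1]
    refine le_relPerimeter E (h1.add k1) (h2.add k2) ?_ ?_
    · refine (tsupport_add φ ψ).trans (union_subset_union h3 k3)
    · intro x
      by_cases hx : x ∈ A
      · have : ψ x = 0 := image_eq_zero_of_notMem_tsupport
          fun h => (disjoint_left.1 hAB hx) (k3 h)
        simpa [this] using h4 x
      · have : φ x = 0 := image_eq_zero_of_notMem_tsupport fun h => hx (h3 h)
        simpa [this] using k4 x
  generalize hc : relPerimeter E (A ∪ B) = c at key
  by_cases hct : c = ⊤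
  · rw [hct]; exact le_top
  have hA : ∀ ψ : EuclideanSpace ℝ (Fin n) → EuclideanSpace ℝ (Fin n),
      ContDiff ℝ 1 ψ → HasCompactSupport ψ → tsupport ψ ⊆ B → (∀ x, ‖ψ x‖ ≤ 1) →
      relPerimeter E A + ENNReal.ofReal (∫ x in E, vdiv ψ x) ≤ c := by
    intro ψ k1 k2 k3 k4
    have hle : ENNReal.ofReal (∫ x in E, vdiv ψ x) ≤ c := by
      rw [← hc]; exact le_relPerimeter E k1 k2 (k3.trans subset_union_right) k4
    refine add_le_of_le_tsub_right_of_le hle ?_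
    refine iSup_le fun φ => iSup_le fun h1 => iSup_le fun h2 => iSup_le fun h3 =>
      iSup_le fun h4 => ?_
    exact ENNReal.le_sub_of_add_le_right ENNReal.ofReal_ne_top (key φ ψ h1 h2 h3 h4 k1 k2 k3 k4)
  have hle : relPerimeter E A ≤ c := by
    rw [← hc]; exact relPerimeter_mono E subset_union_left
  refine add_le_of_le_tsub_left_of_le hle ?_
  refine iSup_le fun ψ => iSup_le fun h1 => iSup_le fun h2 => iSup_le fun h3 =>
    iSup_le fun h4 => ?_
  exact ENNReal.le_sub_of_add_le_left (ne_top_of_le_ne_top hct hle) (hA ψ h1 h2 h3 h4)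

theorem sum_relPerimeter_le {n : ℕ} {ι : Type*} (E : Set (EuclideanSpace ℝ (Fin n)))
    (s : Set ι) (A : ι → Set (EuclideanSpace ℝ (Fin n))) (hs : s.PairwiseDisjoint A) :
    ∑' i : s, relPerimeter E (A i) ≤ perimeter E := by
  classical
  rw [ENNReal.tsum_eq_iSup_sum]
  refine iSup_le fun F => ?_
  have : ∑ i ∈ F, relPerimeter E (A i) ≤ relPerimeter E (⋃ i ∈ F, A i) := by
    induction F using Finset.induction_on with
    | empty => simp
    | insert a F ha ih =>
      rw [Finset.sum_insert ha, Finset.set_biUnion_insert]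
      refine le_trans (add_le_add le_rfl ih) (relPerimeter_add_le E ?_)
      rw [disjoint_iUnion₂_right]
      intro i hi
      exact hs a.2 i.2 fun h => ha (Subtype.ext h ▸ hi)
  exact this.trans (relPerimeter_mono E (subset_univ _))

theorem volume_ball_three {n : ℕ} (x y : EuclideanSpace ℝ (Fin n)) (r : ℝ) :
    volume (ball x (3 * r)) = (3 : ℝ≥0∞) ^ n * volume (ball y r) := by
  rw [Measure.addHaar_ball_mul_of_pos volume x (by norm_num : (0 : ℝ) < 3) r,
    finrank_euclideanSpace_fin, Measure.addHaar_ball_center volume y r,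
    ENNReal.ofReal_pow (by norm_num)]
  norm_num

theorem tendsto_compl_density {n : ℕ} {Ω : Set (EuclideanSpace ℝ (Fin n))}
    (hΩ : MeasurableSet Ω) {y : EuclideanSpace ℝ (Fin n)} (hy : y ∈ densityPts Ω 1) :
    Tendsto (fun r : ℝ => volume (ball y r \ Ω) / volume (ball y r)) (𝓝[>] 0) (𝓝 0) := by
  have h1 : Tendsto (fun r : ℝ => 1 - volume (Ω ∩ ball y r) / volume (ball y r)) (𝓝[>] 0)
      (𝓝 (1 - 1)) := ENNReal.Tendsto.sub tendsto_const_nhds hy (Or.inl (by simp))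
  rw [tsub_self] at h1
  refine h1.congr' ?_
  filter_upwards [self_mem_nhdsWithin] with r hr
  have hr : 0 < r := hr
  have h0 : volume (ball y r) ≠ 0 := (measure_ball_pos _ _ hr).ne'
  have ht : volume (ball y r) ≠ ⊤ := measure_ball_lt_top.ne
  have h2 : volume (ball y r) = volume (Ω ∩ ball y r) + volume (ball y r \ Ω) := by
    rw [inter_comm]; exact (measure_inter_add_sdiff _ hΩ).symm
  have h3 : volume (ball y r \ Ω) = volume (ball y r) - volume (Ω ∩ ball y r) := by
    refine ENNReal.eq_sub_of_add_eq ?_ ?_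
    · exact ne_top_of_le_ne_top ht (measure_mono inter_subset_right)
    · rw [add_comm]; exact h2.symm
  rw [h3, ENNReal.sub_div (fun _ _ => h0), ENNReal.div_self h0 ht]

theorem essBoundary_inter_subset {n : ℕ} {ι : Type*} {N : ℕ}
    {Ω D : Set (EuclideanSpace ℝ (Fin n))} (hΩ : MeasurableSet Ω) (hD : volume D ≠ ⊤)
    (s : Fin N → Set ι) (c : ι → EuclideanSpace ℝ (Fin n)) (ρ : ι → ℝ) (hρ : ∀ j, 0 < ρ j)
    (hdisj : ∀ i, (s i).PairwiseDisjoint fun j => closedBall (c j) (ρ j))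
    (hhalf : ∀ j, 2 * volume (Ω ∩ ball (c j) (ρ j)) ≤ volume (ball (c j) (ρ j)))
    (hsub : ∀ j, ball (c j) (ρ j) ⊆ D) :
    essBoundary (⋃ i, ⋃ j ∈ s i, ball (c j) (ρ j)) ∩ densityPts Ω 1 ⊆
      ⋃ i, ⋃ j ∈ s i, sphere (c j) (ρ j) := by
  set U := ⋃ i, ⋃ j ∈ s i, ball (c j) (ρ j) with hU
  rintro y ⟨hyU, hy⟩
  by_contra hys
  have hUo : IsOpen U := isOpen_iUnion fun i => isOpen_biUnion fun j _ => isOpen_ball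
  have hdb : ∀ i, (s i).PairwiseDisjoint fun j => ball (c j) (ρ j) := fun i j hj k hk hjk =>
    (hdisj i hj hk hjk).mono ball_subset_closedBall ball_subset_closedBall
  apply hyU.2
  by_cases hyin : y ∈ U
  · right
    obtain ⟨r0, hr0, hr0U⟩ := Metric.isOpen_iff.1 hUo y hyin
    refine tendsto_const_nhds.congr' ?_
    filter_upwards [Ioo_mem_nhdsGT hr0] with r hr
    rw [inter_eq_self_of_subset_right ((ball_subset_ball hr.2.le).trans hr0U),
      ENNReal.div_self (measure_ball_pos _ _ hr.1).ne' measure_ball_lt_top.ne]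
  left
  have hclosed : ∀ i, ∀ j ∈ s i, y ∉ closedBall (c j) (ρ j) := by
    intro i j hj hyj
    rw [← ball_union_sphere] at hyj
    rcases hyj with h | h
    · exact hyin (mem_iUnion.2 ⟨i, mem_iUnion₂.2 ⟨j, hj, h⟩⟩)
    · exact hys (mem_iUnion.2 ⟨i, mem_iUnion₂.2 ⟨j, hj, h⟩⟩)
  have hcomp := tendsto_compl_density hΩ hy
  -- the volume of each ball is controlled by its part outside
  have hout : ∀ j, volume (ball (c j) (ρ j)) ≤ 2 * volume (ball (c j) (ρ j) \ Ω) := by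
    intro j
    have h2 : volume (ball (c j) (ρ j)) =
        volume (Ω ∩ ball (c j) (ρ j)) + volume (ball (c j) (ρ j) \ Ω) := by
      rw [inter_comm]; exact (measure_inter_add_sdiff _ hΩ).symm
    have hfin : volume (Ω ∩ ball (c j) (ρ j)) ≠ ⊤ :=
      ne_top_of_le_ne_top measure_ball_lt_top.ne (measure_mono inter_subset_right)
    have h3 := hhalf j
    rw [h2, two_mul] at h3
    have h4 := (ENNReal.add_le_add_iff_left hfin).1 h3
    rw [h2, two_mul]
    gcongr
  have hthree0 : (3 : ℝ≥0∞) ^ n ≠ 0 := by simp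
  have hthree : (3 : ℝ≥0∞) ^ n ≠ ⊤ := by simp
  obtain ⟨T, hT, hTκ⟩ : ∃ T : ℝ, 0 < T ∧ ∀ t, 0 < t → t < T →
      volume (ball y t \ Ω) / volume (ball y t) < (2 * 3 ^ n)⁻¹ := by
    have hpos : (0 : ℝ≥0∞) < (2 * 3 ^ n)⁻¹ := by
      rw [ENNReal.inv_pos]; exact ENNReal.mul_ne_top (by simp) hthree
    have := (hcomp.eventually (gt_mem_nhds hpos))
    rw [eventually_nhdsWithin_iff, Metric.eventually_nhds_iff] at this
    obtain ⟨T, hT, h⟩ := this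
    refine ⟨T, hT, fun t ht htT => h ?_ ht⟩
    rw [Real.dist_eq, sub_zero, abs_of_pos ht]; exact htT
  -- finitely many large balls
  have hfinite : ∀ i, {j ∈ s i | T / 3 ≤ ρ j}.Finite := by
    intro i
    have h1 := Measure.finite_const_le_meas_of_disjoint_iUnion volume
      (ε := volume (ball y (T / 3))) (measure_ball_pos _ _ (by positivity))
      (As := fun j : s i => ball (c j) (ρ j)) (fun j => measurableSet_ball)
      (fun a b hab => hdb i a.2 b.2 fun h => hab (Subtype.ext h))
      (ne_top_of_le_ne_top hD (measure_mono (iUnion_subset fun j => hsub j)))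
    refine (h1.image Subtype.val).subset ?_
    rintro j ⟨hj, hjT⟩
    refine ⟨⟨j, hj⟩, ?_, rfl⟩
    simp only [mem_setOf_eq]
    rw [Measure.addHaar_ball_center volume y, ← Measure.addHaar_ball_center volume (c j)]
    exact measure_mono (ball_subset_ball hjT)
  obtain ⟨s1, hs1, hs1d⟩ : ∃ s1 > 0, ∀ i, ∀ j ∈ s i, T / 3 ≤ ρ j →
      Disjoint (ball (c j) (ρ j)) (ball y s1) := by
    have hcl : IsClosed (⋃ i, ⋃ j ∈ {j ∈ s i | T / 3 ≤ ρ j}, closedBall (c j) (ρ j)) :=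
      isClosed_iUnion_of_finite fun i => (hfinite i).isClosed_biUnion fun j _ => isClosed_closedBall
    have hyc : y ∈ (⋃ i, ⋃ j ∈ {j ∈ s i | T / 3 ≤ ρ j}, closedBall (c j) (ρ j))ᶜ := by
      intro h
      obtain ⟨i, hi⟩ := mem_iUnion.1 h
      obtain ⟨j, hj, hij⟩ := mem_iUnion₂.1 hi
      exact hclosed i j hj.1 hij
    obtain ⟨s1, hs1, h⟩ := Metric.isOpen_iff.1 hcl.isOpen_compl y hyc
    refine ⟨s1, hs1, fun i j hj hjT => ?_⟩
    rw [disjoint_left]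
    intro z hz hz2
    exact h hz2 (mem_iUnion.2 ⟨i, mem_iUnion₂.2 ⟨j, ⟨hj, hjT⟩, ball_subset_closedBall hz⟩⟩)
  have hsmall : ∀ r, 0 < r → r < s1 → ∀ i, ∀ j ∈ s i,
      (ball (c j) (ρ j) ∩ ball y r).Nonempty → ball (c j) (ρ j) ⊆ ball y (3 * r) := by
    rintro r hr hrs i j hj ⟨z, hz1, hz2⟩
    have hρT : ρ j < T / 3 := by
      by_contra hcon
      exact disjoint_left.1 (hs1d i j hj (not_lt.1 hcon)) hz1 (ball_subset_ball hrs.le hz2)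
    have hd : dist (c j) y < ρ j + r := by
      have := dist_triangle (c j) z y
      rw [mem_ball] at hz1 hz2
      rw [dist_comm] at hz1
      linarith
    have hρr : ρ j < r := by
      by_contra hcon
      have hcon := not_lt.1 hcon
      have hsubb : ball (c j) (ρ j) ⊆ ball y (3 * ρ j) := by
        refine ball_subset_ball' ?_
        linarith
      have h1 := hTκ (3 * ρ j) (by linarith [hρ j]) (by linarith)
      have h2 : volume (ball (c j) (ρ j)) ≤ 2 * volume (ball y (3 * ρ j) \ Ω) :=
        (hout j).trans (by gcongr)
      rw [volume_ball_three y (c j)] at h1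
      have hb0 : volume (ball (c j) (ρ j)) ≠ 0 := (measure_ball_pos _ _ (hρ j)).ne'
      have hbt : volume (ball (c j) (ρ j)) ≠ ⊤ := measure_ball_lt_top.ne
      rw [ENNReal.div_lt_iff (Or.inl (mul_ne_zero hthree0 hb0))
        (Or.inl (ENNReal.mul_ne_top hthree hbt))] at h1
      have h3 : (2 * 3 ^ n : ℝ≥0∞)⁻¹ * (3 ^ n * volume (ball (c j) (ρ j))) =
          2⁻¹ * volume (ball (c j) (ρ j)) := by
        rw [ENNReal.mul_inv (Or.inl (by simp)) (Or.inl (by simp)), mul_assoc, ← mul_assoc (_⁻¹) (3 ^ n),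
          ENNReal.inv_mul_cancel hthree0 hthree, one_mul]
      rw [h3] at h1
      have h4 : 2 * volume (ball y (3 * ρ j) \ Ω) < 2 * (2⁻¹ * volume (ball (c j) (ρ j))) :=
        ENNReal.mul_lt_mul_right (by simp) (by simp) h1
      rw [← mul_assoc, ENNReal.mul_inv_cancel (by simp) (by simp), one_mul] at h4
      exact absurd h2 (not_le.2 h4)
    refine ball_subset_ball' ?_
    linarith
  have hbound : ∀ r, 0 < r → r < s1 → volume (U ∩ ball y r) / volume (ball y r) ≤
      (N * (2 * 3 ^ n) : ℝ≥0∞) * (volume (ball y (3 * r) \ Ω) / volume (ball y (3 * r))) := by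
    intro r hr hrs
    have h1 : volume (U ∩ ball y r) ≤ N * (2 * volume (ball y (3 * r) \ Ω)) := by
      rw [hU, iUnion_inter]
      refine (measure_iUnion_le _).trans ?_
      rw [tsum_fintype]
      refine (Finset.sum_le_card_nsmul _ _ (2 * volume (ball y (3 * r) \ Ω)) fun i _ => ?_).trans
        (by simp)
      set s' := {j ∈ s i | (ball (c j) (ρ j) ∩ ball y r).Nonempty} with hs'
      have hcount : s'.Countable := by
        refine Set.Countable.mono (fun j hj => hj.1) ((hdb i).countable_of_isOpen
          (fun j _ => isOpen_ball) (fun j _ => ⟨c j, mem_ball_self (hρ j)⟩))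
      have hss : (⋃ j ∈ s i, ball (c j) (ρ j)) ∩ ball y r ⊆ ⋃ j ∈ s', ball (c j) (ρ j) := by
        rintro z ⟨hz1, hz2⟩
        obtain ⟨j, hj, hjz⟩ := mem_iUnion₂.1 hz1
        exact mem_iUnion₂.2 ⟨j, ⟨hj, ⟨z, hjz, hz2⟩⟩, hjz⟩
      calc _ ≤ volume (⋃ j ∈ s', ball (c j) (ρ j)) := measure_mono hss
        _ ≤ ∑' j : s', volume (ball (c j) (ρ j)) := measure_biUnion_le _ hcount _
        _ ≤ ∑' j : s', 2 * volume (ball (c j) (ρ j) \ Ω) :=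
            ENNReal.tsum_le_tsum fun j => hout j
        _ = 2 * ∑' j : s', volume (ball (c j) (ρ j) \ Ω) := ENNReal.tsum_mul_left
        _ = 2 * volume (⋃ j ∈ s', (ball (c j) (ρ j) \ Ω)) := by
            rw [measure_biUnion hcount _ fun j _ => measurableSet_ball.diff hΩ]
            intro j hj k hk hjk
            exact (hdb i hj.1 hk.1 hjk).mono sdiff_subset sdiff_subset
        _ ≤ _ := by
            gcongr
            refine iUnion₂_subset fun j hj => ?_
            exact sdiff_subset_sdiff_left (hsmall r hr hrs i j hj.1 hj.2)
    have hb0 : volume (ball y r) ≠ 0 := (measure_ball_pos _ _ hr).ne'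
    have hbt : volume (ball y r) ≠ ⊤ := measure_ball_lt_top.ne
    rw [volume_ball_three y y r]
    refine (ENNReal.div_le_div_right h1 _).trans (le_of_eq ?_)
    simp only [div_eq_mul_inv]
    rw [ENNReal.mul_inv (Or.inl hthree0) (Or.inl hthree)]
    have : (3 : ℝ≥0∞) ^ n * (3 ^ n)⁻¹ = 1 := ENNReal.mul_inv_cancel hthree0 hthree
    calc _ = (N : ℝ≥0∞) * (2 * volume (ball y (3 * r) \ Ω)) * (volume (ball y r))⁻¹
          * ((3 : ℝ≥0∞) ^ n * (3 ^ n)⁻¹) := by rw [this, mul_one]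
      _ = _ := by ring
  have hlim3 : Tendsto (fun r : ℝ => 3 * r) (𝓝[>] 0) (𝓝[>] 0) := by
    refine tendsto_nhdsWithin_iff.2 ⟨?_, ?_⟩
    · have : Tendsto (fun r : ℝ => 3 * r) (𝓝 0) (𝓝 (3 * 0)) := by
        exact (continuous_const.mul continuous_id).tendsto 0
      rw [mul_zero] at this
      exact this.mono_left nhdsWithin_le_nhds
    · filter_upwards [self_mem_nhdsWithin] with r hr
      have : (0 : ℝ) < r := hr
      simp [this]
  have hlim := ENNReal.Tendsto.const_mul (a := (N * (2 * 3 ^ n) : ℝ≥0∞)) (hcomp.comp hlim3)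
    (Or.inr (ENNReal.mul_ne_top (by simp) (ENNReal.mul_ne_top (by simp) hthree)))
  rw [mul_zero] at hlim
  refine tendsto_of_tendsto_of_tendsto_of_le_of_le' tendsto_const_nhds hlim
    (Eventually.of_forall fun _ => zero_le) ?_
  filter_upwards [Ioo_mem_nhdsGT hs1] with r hr
  exact hbound r hr.1 hr.2

open scoped Convolution in
theorem moll_field {n : ℕ} {ρ : EuclideanSpace ℝ (Fin n) → ℝ} (hρ : ContDiff ℝ 1 ρ)
    (hρc : HasCompactSupport ρ) (hρ0 : ∀ x, 0 ≤ ρ x) (hρ1 : ∫ x, ρ x = 1)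
    {φ : EuclideanSpace ℝ (Fin n) → EuclideanSpace ℝ (Fin n)} (hφ : Integrable φ)
    (hφ1 : ∀ x, ‖φ x‖ ≤ 1) :
    ∃ Φ : EuclideanSpace ℝ (Fin n) → EuclideanSpace ℝ (Fin n), ContDiff ℝ 1 Φ ∧
      (∀ x, ‖Φ x‖ ≤ 1) ∧ ∀ t, vdiv Φ t = ∫ x, fderiv ℝ ρ (t - x) (φ x) := by
  set L : EuclideanSpace ℝ (Fin n) →L[ℝ] ℝ →L[ℝ] EuclideanSpace ℝ (Fin n) :=
    (ContinuousLinearMap.lsmul ℝ ℝ).flip with hL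
  have hloc : LocallyIntegrable φ volume := hφ.locallyIntegrable
  refine ⟨φ ⋆[L] ρ, ?_, ?_, ?_⟩
  · exact_mod_cast hρc.contDiff_convolution_right (n := 1) L hloc (by exact_mod_cast hρ)
  · intro x
    rw [convolution_def]
    have hint : Integrable (fun t => ρ (x - t)) :=
      (hρ.continuous.integrable_of_hasCompactSupport hρc).comp_sub_left x
    calc ‖∫ t, L (φ t) (ρ (x - t))‖ ≤ ∫ t, ρ (x - t) := by
          refine norm_integral_le_of_norm_le hint (Eventually.of_forall fun t => ?_)
          simp only [hL, ContinuousLinearMap.flip_apply, ContinuousLinearMap.lsmul_apply, norm_smul,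
            Real.norm_eq_abs, abs_of_nonneg (hρ0 _)]
          exact mul_le_of_le_one_right (hρ0 _) (hφ1 t)
      _ = 1 := by rw [integral_sub_left_eq_self (fun y => ρ y) volume x, hρ1]
  · intro t
    have hd := hρc.hasFDerivAt_convolution_right L hloc hρ t
    have hex : Integrable (fun x => (L.precompR (EuclideanSpace ℝ (Fin n))) (φ x)
        (fderiv ℝ ρ (t - x))) :=
      (hρc.fderiv (𝕜 := ℝ)).convolutionExists_right (L.precompR (EuclideanSpace ℝ (Fin n))) hloc
        (hρ.continuous_fderiv one_ne_zero) t
    unfold vdiv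
    rw [hd.fderiv, convolution_def]
    have h1 : ∀ i : Fin n, (((∫ x, (L.precompR (EuclideanSpace ℝ (Fin n))) (φ x)
        (fderiv ℝ ρ (t - x))) (EuclideanSpace.single i 1)) i : ℝ) =
        ∫ x, fderiv ℝ ρ (t - x) (EuclideanSpace.single i 1) * φ x i := by
      intro i
      rw [ContinuousLinearMap.integral_apply hex]
      have h2 := (EuclideanSpace.proj i : EuclideanSpace ℝ (Fin n) →L[ℝ] ℝ).integral_comp_comm
        (hex.apply_continuousLinearMap (EuclideanSpace.single i 1))
      refine Eq.trans h2.symm ?_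
      rfl
    have h3 : ∀ i : Fin n, Integrable
        (fun x => fderiv ℝ ρ (t - x) (EuclideanSpace.single i 1) * φ x i) := by
      intro i
      exact (EuclideanSpace.proj i : EuclideanSpace ℝ (Fin n) →L[ℝ] ℝ).integrable_comp
        (hex.apply_continuousLinearMap (EuclideanSpace.single i 1))
    simp_rw [h1]
    rw [← integral_finsetSum _ fun i _ => h3 i]
    congr 1
    ext x
    conv_rhs => rw [← (EuclideanSpace.basisFun (Fin n) ℝ).sum_repr (φ x)]
    rw [map_sum]
    refine Finset.sum_congr rfl fun i _ => ?_
    simp [mul_comm]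

theorem vdiv_smul {n : ℕ} {ψ : EuclideanSpace ℝ (Fin n) → ℝ} (hψ : ContDiff ℝ 1 ψ)
    {Φ : EuclideanSpace ℝ (Fin n) → EuclideanSpace ℝ (Fin n)} (hΦ : ContDiff ℝ 1 Φ)
    (x : EuclideanSpace ℝ (Fin n)) :
    vdiv (fun y => ψ y • Φ y) x = ψ x * vdiv Φ x + fderiv ℝ ψ x (Φ x) := by
  unfold vdiv
  rw [fderiv_fun_smul (hψ.differentiable one_ne_zero x) (hΦ.differentiable one_ne_zero x)]
  conv_rhs => rw [← (EuclideanSpace.basisFun (Fin n) ℝ).sum_repr (Φ x)]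
  rw [map_sum, Finset.mul_sum, ← Finset.sum_add_distrib]
  refine Finset.sum_congr rfl fun i _ => ?_
  simp [mul_comm]

open scoped Convolution in
theorem moll_grad_bound {n : ℕ} {ρ : EuclideanSpace ℝ (Fin n) → ℝ} (hρ : ContDiff ℝ 1 ρ)
    (hρc : HasCompactSupport ρ) (hρ0 : ∀ x, 0 ≤ ρ x) (hρ1 : ∫ x, ρ x = 1)
    (hρe : ∀ x, ρ (-x) = ρ x) {Ω W : Set (EuclideanSpace ℝ (Fin n))} (hΩ : MeasurableSet Ω)
    {ψ : EuclideanSpace ℝ (Fin n) → ℝ} (hψ : ContDiff ℝ 1 ψ) (hψc : HasCompactSupport ψ)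
    (hψ1 : ∀ x, ‖ψ x‖ ≤ 1) (hψW : tsupport ψ ⊆ W) :
    ∫⁻ x, ‖fderiv ℝ (Ω.indicator ψ ⋆[ContinuousLinearMap.lsmul ℝ ℝ] ρ) x‖ₑ ≤
      relPerimeter Ω W + ∫⁻ x in Ω, ‖fderiv ℝ ψ x‖ₑ := by
  set g := Ω.indicator ψ with hg
  set L : ℝ →L[ℝ] ℝ →L[ℝ] ℝ := ContinuousLinearMap.lsmul ℝ ℝ with hL
  have hψi : Integrable ψ := hψ.continuous.integrable_of_hasCompactSupport hψc
  have hgi : Integrable g := hψi.indicator hΩ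
  have hgc : HasCompactSupport g := hψc.mono (by
    intro x hx h; apply hx; simp [hg, h])
  set u := g ⋆[L] ρ with hu
  have hu1 : ContDiff ℝ 1 u := by
    exact_mod_cast hρc.contDiff_convolution_right (n := 1) L hgi.locallyIntegrable
      (by exact_mod_cast hρ)
  have huc : HasCompactSupport u := hgc.convolution L hρc
  have hdu : Continuous (fderiv ℝ u) := hu1.continuous_fderiv one_ne_zero
  have hduc : HasCompactSupport (fderiv ℝ u) := huc.fderiv (𝕜 := ℝ)
  have hdρ : Continuous (fderiv ℝ ρ) := hρ.continuous_fderiv one_ne_zero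
  have hfd : ∀ x w, fderiv ℝ u x w = ∫ t, g t * fderiv ℝ ρ (x - t) w := by
    intro x w
    have hd := hρc.hasFDerivAt_convolution_right L hgi.locallyIntegrable hρ x
    have hex : Integrable (fun t => (L.precompR (EuclideanSpace ℝ (Fin n))) (g t)
        (fderiv ℝ ρ (x - t))) :=
      (hρc.fderiv (𝕜 := ℝ)).convolutionExists_right (L.precompR (EuclideanSpace ℝ (Fin n)))
        hgi.locallyIntegrable hdρ x
    rw [hd.fderiv, convolution_def, ContinuousLinearMap.integral_apply hex]
    rfl
  -- the direction field
  set v : EuclideanSpace ℝ (Fin n) → EuclideanSpace ℝ (Fin n) :=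
    fun x => (InnerProductSpace.toDual ℝ _).symm (fderiv ℝ u x) with hv
  have hvc : Continuous v := (InnerProductSpace.toDual ℝ _).symm.continuous.comp hdu
  have hvn : ∀ x, ‖v x‖ = ‖fderiv ℝ u x‖ := fun x => LinearIsometryEquiv.norm_map _ _
  set φ : EuclideanSpace ℝ (Fin n) → EuclideanSpace ℝ (Fin n) := fun x => ‖v x‖⁻¹ • v x with hφ
  have hφ1 : ∀ x, ‖φ x‖ ≤ 1 := by
    intro x
    rw [hφ]; simp only [norm_smul, norm_inv, norm_norm]
    exact inv_mul_le_one
  have hφm : Measurable φ := (hvc.norm.measurable.inv).smul hvc.measurable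
  have hφu : ∀ x, fderiv ℝ u x (φ x) = ‖fderiv ℝ u x‖ := by
    intro x
    have h1 : fderiv ℝ u x (v x) = ‖v x‖ * ‖v x‖ := by
      rw [← real_inner_self_eq_norm_mul_norm]
      exact (InnerProductSpace.toDual_symm_apply (x := v x) (y := fderiv ℝ u x)).symm
    rw [hφ]; simp only [map_smul, smul_eq_mul]
    rw [h1, ← hvn]
    by_cases h0 : ‖v x‖ = 0
    · simp [h0]
    · field_simp
  set K := tsupport (fderiv ℝ u) with hK
  have hKc : IsCompact K := hduc
  have hφK : ∀ x, x ∉ K → φ x = 0 := by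
    intro x hx
    have : v x = 0 := by
      rw [hv]; simp only; rw [image_eq_zero_of_notMem_tsupport hx, map_zero]
    rw [hφ]; simp [this]
  have hφle : ∀ x, ‖φ x‖ ≤ K.indicator (fun _ => (1 : ℝ)) x := by
    intro x
    by_cases hx : x ∈ K
    · rw [indicator_of_mem hx]; exact hφ1 x
    · rw [indicator_of_notMem hx, hφK x hx, norm_zero]
  have hKi : Integrable (K.indicator (fun _ => (1 : ℝ))) :=
    (integrable_indicator_iff hKc.measurableSet).2
      (integrableOn_const hKc.measure_lt_top.ne)
  have hφi : Integrable φ := hKi.mono' hφm.aestronglyMeasurable (Eventually.of_forall hφle)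
  obtain ⟨Φ, hΦ, hΦ1, hΦd⟩ := moll_field hρ hρc hρ0 hρ1 hφi hφ1
  have hodd : ∀ z w, fderiv ℝ ρ (-z) w = - fderiv ℝ ρ z w := by
    intro z w
    have h2 := (hρ.differentiable one_ne_zero (-z)).hasFDerivAt.comp z (hasFDerivAt_id z).neg
    have h4 : HasFDerivAt ρ ((fderiv ℝ ρ (-z)).comp
        (-(ContinuousLinearMap.id ℝ (EuclideanSpace ℝ (Fin n))))) z := by
      exact h2.congr_of_eventuallyEq (Eventually.of_forall fun y => (hρe y).symm)
    rw [h4.fderiv]; simp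
  -- Fubini
  obtain ⟨M, hM⟩ := hdρ.bounded_above_of_compact_support (hρc.fderiv (𝕜 := ℝ))
  have happ : ∀ y w, fderiv ℝ ρ y w =
      ∑ i, w i * fderiv ℝ ρ y (EuclideanSpace.single i 1) := by
    intro y w
    conv_lhs => rw [← (EuclideanSpace.basisFun (Fin n) ℝ).sum_repr w]
    rw [map_sum]
    simp
  have hmeas : Measurable (fun p : EuclideanSpace ℝ (Fin n) × EuclideanSpace ℝ (Fin n) =>
      fderiv ℝ ρ (p.1 - p.2) (φ p.1)) := by
    have hsum : (fun p : EuclideanSpace ℝ (Fin n) × EuclideanSpace ℝ (Fin n) =>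
        fderiv ℝ ρ (p.1 - p.2) (φ p.1)) = fun p =>
        ∑ i, φ p.1 i * fderiv ℝ ρ (p.1 - p.2) (EuclideanSpace.single i 1) :=
      funext fun p => happ _ _
    rw [hsum]
    refine Finset.measurable_sum _ fun i _ => ?_
    refine Measurable.mul ?_ ?_
    · have h1 : Measurable (fun x => φ x i) :=
        (EuclideanSpace.proj i : EuclideanSpace ℝ (Fin n) →L[ℝ] ℝ).continuous.measurable.comp hφm
      exact h1.comp measurable_fst
    · have : Continuous (fun p : EuclideanSpace ℝ (Fin n) × EuclideanSpace ℝ (Fin n) =>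
        fderiv ℝ ρ (p.1 - p.2) (EuclideanSpace.single i 1)) := by fun_prop
      exact this.measurable
  have hgm : Measurable g := hψ.continuous.measurable.indicator hΩ
  have hprod : Integrable (Function.uncurry fun x t => g t * fderiv ℝ ρ (x - t) (φ x))
      (volume.prod volume) := by
    have hb : Integrable (fun p : EuclideanSpace ℝ (Fin n) × EuclideanSpace ℝ (Fin n) =>
        K.indicator (fun _ => (1 : ℝ)) p.1 * (M * ‖g p.2‖)) (volume.prod volume) :=
      hKi.mul_prod (hgi.norm.const_mul M)
    refine hb.mono' ?_ (Eventually.of_forall ?_)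
    · exact ((hgm.comp measurable_snd).mul hmeas).aestronglyMeasurable
    · rintro ⟨x, t⟩
      simp only [Function.uncurry, norm_mul]
      have h1 : ‖fderiv ℝ ρ (x - t) (φ x)‖ ≤ M * K.indicator (fun _ => (1 : ℝ)) x :=
        ((fderiv ℝ ρ (x - t)).le_opNorm _).trans
          (mul_le_mul (hM _) (hφle x) (norm_nonneg _) ((norm_nonneg _).trans (hM 0)))
      calc ‖g t‖ * ‖fderiv ℝ ρ (x - t) (φ x)‖ ≤ ‖g t‖ * (M * K.indicator (fun _ => (1 : ℝ)) x) := by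
            gcongr
        _ = _ := by ring
  have hmain : ∫ x, ‖fderiv ℝ u x‖ = ∫ t, g t * (- vdiv Φ t) := by
    calc ∫ x, ‖fderiv ℝ u x‖ = ∫ x, ∫ t, g t * fderiv ℝ ρ (x - t) (φ x) := by
          congr 1; ext x; rw [← hφu, hfd]
      _ = ∫ t, ∫ x, g t * fderiv ℝ ρ (x - t) (φ x) := integral_integral_swap hprod
      _ = _ := by
          congr 1; ext t
          rw [integral_const_mul, hΦd, ← integral_neg]
          congr 2; ext x
          rw [← hodd, neg_sub]
  -- conclude
  have hψΦ : ContDiff ℝ 1 (fun y => (-ψ y) • Φ y) := hψ.neg.smul hΦ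
  have hψΦc : HasCompactSupport (fun y => (-ψ y) • Φ y) := hψc.mono (by
    intro x hx h; apply hx; simp [h])
  have hts : tsupport (fun y => (-ψ y) • Φ y) ⊆ W := by
    refine Subset.trans (closure_mono ?_) hψW
    intro x hx h; apply hx; simp [h]
  have hbd : ∀ x, ‖(-ψ x) • Φ x‖ ≤ 1 := by
    intro x
    rw [norm_smul, norm_neg]
    exact mul_le_one₀ (hψ1 x) (norm_nonneg _) (hΦ1 x)
  have hper := le_relPerimeter Ω hψΦ hψΦc hts hbd
  have hdψ : Continuous (fderiv ℝ ψ) := hψ.continuous_fderiv one_ne_zero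
  have hdψc : HasCompactSupport (fderiv ℝ ψ) := hψc.fderiv (𝕜 := ℝ)
  have hdi : Integrable (fun x => fderiv ℝ ψ x (Φ x)) := by
    refine (hdψ.clm_apply hΦ.continuous).integrable_of_hasCompactSupport (hdψc.mono ?_)
    intro x hx h; apply hx; simp [h]
  have hsplit : ∫ t, g t * (- vdiv Φ t) =
      (∫ x in Ω, vdiv (fun y => (-ψ y) • Φ y) x) + ∫ x in Ω, fderiv ℝ ψ x (Φ x) := by
    rw [← integral_add (integrable_vdiv hψΦ hψΦc).integrableOn hdi.integrableOn,
      ← integral_indicator hΩ]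
    congr 1; ext t
    by_cases ht : t ∈ Ω
    · rw [hg, indicator_of_mem ht, indicator_of_mem ht, vdiv_smul hψ.neg hΦ]
      rw [show (fun y => -ψ y) = -ψ from rfl, fderiv_neg]
      simp
    · rw [hg, indicator_of_notMem ht, indicator_of_notMem ht, zero_mul]
  have hlin : ∫⁻ x, ‖fderiv ℝ u x‖ₑ = ENNReal.ofReal (∫ x, ‖fderiv ℝ u x‖) :=
    (ofReal_integral_norm_eq_lintegral_enorm (hdu.integrable_of_hasCompactSupport hduc)).symm
  rw [hlin, hmain, hsplit]
  refine ENNReal.ofReal_add_le.trans (add_le_add hper ?_)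
  calc ENNReal.ofReal (∫ x in Ω, fderiv ℝ ψ x (Φ x))
      ≤ ENNReal.ofReal (∫ x in Ω, ‖fderiv ℝ ψ x‖) := by
        apply ENNReal.ofReal_le_ofReal
        refine integral_mono hdi.integrableOn
          (hdψ.integrable_of_hasCompactSupport hdψc).norm.integrableOn fun x => ?_
        refine (le_abs_self _).trans (((fderiv ℝ ψ x).le_opNorm _).trans ?_)
        exact mul_le_of_le_one_right (norm_nonneg _) (hΦ1 x)
    _ = _ := ofReal_integral_norm_eq_lintegral_enorm
        (hdψ.integrable_of_hasCompactSupport hdψc).integrableOn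

theorem exists_smoothTransition_bound : ∃ M : ℝ, 0 < M ∧
    ∀ t, ‖deriv Real.smoothTransition t‖ ≤ M := by
  have hcd : ContDiff ℝ 1 Real.smoothTransition := Real.smoothTransition.contDiff
  have hc : Continuous (deriv Real.smoothTransition) := hcd.continuous_deriv le_rfl
  have hsupp : HasCompactSupport (deriv Real.smoothTransition) := by
    refine HasCompactSupport.intro (isCompact_Icc (a := (0:ℝ)) (b := 1)) fun x hx => ?_
    rw [mem_Icc, not_and_or, not_le, not_le] at hx
    rcases hx with hx | hx
    · have : Real.smoothTransition =ᶠ[𝓝 x] fun _ => 0 := by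
        filter_upwards [Iio_mem_nhds hx] with y hy
        exact Real.smoothTransition.zero_of_nonpos (le_of_lt hy)
      rw [this.deriv_eq]; simp
    · have : Real.smoothTransition =ᶠ[𝓝 x] fun _ => 1 := by
        filter_upwards [Ioi_mem_nhds hx] with y hy
        exact Real.smoothTransition.one_of_one_le (le_of_lt hy)
      rw [this.deriv_eq]; simp
  obtain ⟨M, hM⟩ := hc.bounded_above_of_compact_support hsupp
  exact ⟨max M 1, by positivity, fun t => (hM t).trans (le_max_left _ _)⟩

theorem exists_cutoff : ∃ M : ℝ, 0 < M ∧ ∀ {n : ℕ} (x : EuclideanSpace ℝ (Fin n)) (a b : ℝ),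
    0 < a → a < b → ∃ ψ : EuclideanSpace ℝ (Fin n) → ℝ, ContDiff ℝ 1 ψ ∧ HasCompactSupport ψ ∧
      (∀ y, ‖ψ y‖ ≤ 1) ∧ (∀ y ∈ ball x a, ψ y = 1) ∧ tsupport ψ ⊆ ball x b ∧
      (∀ y, ‖fderiv ℝ ψ y‖ ≤ M / (b - a)) ∧ (∀ y ∈ ball x a, fderiv ℝ ψ y = 0) := by
  obtain ⟨M, hM0, hM⟩ := exists_smoothTransition_bound
  refine ⟨4 * M, by positivity, fun {n} x a b ha hab => ?_⟩
  set m := (a + b) / 2 with hm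
  have ham : a < m := by rw [hm]; linarith
  have hmb : m < b := by rw [hm]; linarith
  have hD : 0 < m ^ 2 - a ^ 2 := by nlinarith
  set q : EuclideanSpace ℝ (Fin n) → ℝ := fun y => (m ^ 2 - ‖y - x‖ ^ 2) / (m ^ 2 - a ^ 2) with hq
  have hqc : ContDiff ℝ 1 q := by
    refine ContDiff.div_const ?_ _
    exact contDiff_const.sub ((contDiff_id.sub contDiff_const).norm_sq ℝ)
  set ψ : EuclideanSpace ℝ (Fin n) → ℝ := fun y => Real.smoothTransition (q y) with hψ
  have hs : Function.support ψ ⊆ closedBall x m := by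
    intro y hy
    by_contra hc
    rw [mem_closedBall, dist_eq_norm, not_le] at hc
    apply hy
    refine Real.smoothTransition.zero_of_nonpos (div_nonpos_of_nonpos_of_nonneg ?_ hD.le)
    nlinarith
  have hts : tsupport ψ ⊆ closedBall x m := closure_minimal hs isClosed_closedBall
  have hψc : ContDiff ℝ 1 ψ := Real.smoothTransition.contDiff.comp hqc
  have hone : ∀ y ∈ ball x a, ψ y = 1 := by
    intro y hy
    rw [mem_ball, dist_eq_norm] at hy
    refine Real.smoothTransition.one_of_one_le ?_
    rw [le_div_iff₀ hD]
    nlinarith [norm_nonneg (y - x)]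
  refine ⟨ψ, hψc, ?_, ?_, hone, ?_, ?_, ?_⟩
  · exact (isCompact_closedBall x m).of_isClosed_subset (isClosed_tsupport _) hts
  · intro y
    rw [Real.norm_of_nonneg (Real.smoothTransition.nonneg _)]
    exact Real.smoothTransition.le_one _
  · exact hts.trans (closedBall_subset_ball hmb)
  · intro y
    by_cases hy : y ∈ closedBall x m
    · rw [mem_closedBall, dist_eq_norm] at hy
      have h1 : HasFDerivAt (fun y : EuclideanSpace ℝ (Fin n) => ‖y - x‖ ^ 2)
          (2 • (innerSL ℝ (y - x)).comp (ContinuousLinearMap.id ℝ _)) y :=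
        ((hasFDerivAt_id y).sub_const x).norm_sq
      set l : EuclideanSpace ℝ (Fin n) →L[ℝ] ℝ := (2 : ℕ) • (innerSL ℝ (y - x)).comp
          (ContinuousLinearMap.id ℝ (EuclideanSpace ℝ (Fin n))) with hl
      have h2 : HasFDerivAt q ((m ^ 2 - a ^ 2)⁻¹ • (-l)) y := by
        have := (h1.const_sub (m ^ 2)).const_mul ((m ^ 2 - a ^ 2)⁻¹)
        refine this.congr_of_eventuallyEq (Eventually.of_forall fun z => ?_)
        simp only [hq]; ring
      have hdt : HasDerivAt Real.smoothTransition (deriv Real.smoothTransition (q y)) (q y) :=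
        ((Real.smoothTransition.contDiff (n := 1)).differentiable one_ne_zero _).hasDerivAt
      have h3 := hdt.comp_hasFDerivAt y h2
      have h4 : fderiv ℝ ψ y = _ := h3.fderiv
      rw [h4, norm_smul, norm_smul, norm_neg, norm_inv, Real.norm_of_nonneg hD.le, hl,
        ContinuousLinearMap.comp_id]
      have h5 : ‖(2 : ℕ) • innerSL ℝ (y - x)‖ ≤ 2 * m := by
        refine (norm_nsmul_le).trans ?_
        rw [innerSL_apply_norm]
        simpa using hy
      calc ‖deriv Real.smoothTransition (q y)‖ * ((m ^ 2 - a ^ 2)⁻¹ * ‖(2 : ℕ) • innerSL ℝ (y - x)‖)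
          ≤ M * ((m ^ 2 - a ^ 2)⁻¹ * (2 * m)) := by
            gcongr; exact hM _
        _ ≤ 4 * M / (b - a) := by
            rw [inv_mul_eq_div, ← mul_div_assoc, div_le_div_iff₀ hD (by linarith)]
            have : b - a = 2 * (m - a) := by rw [hm]; ring
            rw [this]
            nlinarith [mul_pos hM0 (mul_pos ha (sub_pos.2 ham))]
    · have : ψ =ᶠ[𝓝 y] fun _ => 0 := by
        filter_upwards [isClosed_closedBall.isOpen_compl.mem_nhds hy] with z hz
        by_contra h
        exact hz (hs h)
      rw [this.fderiv_eq]
      have : 0 < b - a := by linarith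
      simp; positivity
  · intro y hy
    have : ψ =ᶠ[𝓝 y] fun _ => 1 := by
      filter_upwards [isOpen_ball.mem_nhds hy] with z hz
      exact hone z hz
    rw [this.fderiv_eq]
    simp

open scoped Convolution in
theorem sobolev_indicator (n : ℕ) {p : ℝ≥0} (hp : NNReal.HolderConjugate (n : ℝ≥0) p) :
    ∃ K : ℝ≥0, ∀ (Ω W : Set (EuclideanSpace ℝ (Fin n))), MeasurableSet Ω →
    ∀ ψ : EuclideanSpace ℝ (Fin n) → ℝ, ContDiff ℝ 1 ψ → HasCompactSupport ψ →
    (∀ x, ‖ψ x‖ ≤ 1) → tsupport ψ ⊆ W →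
    eLpNorm (Ω.indicator ψ) p volume ≤
      K * (relPerimeter Ω W + ∫⁻ x in Ω, ‖fderiv ℝ ψ x‖ₑ) := by
  have hp' : NNReal.HolderConjugate (Module.finrank ℝ (EuclideanSpace ℝ (Fin n)) : ℝ≥0) p := by
    simpa using hp
  refine ⟨eLpNormLESNormFDerivOneConst (volume : Measure (EuclideanSpace ℝ (Fin n))) p,
    fun Ω W hΩ ψ hψ hψc hψ1 hψW => ?_⟩
  set K := eLpNormLESNormFDerivOneConst (volume : Measure (EuclideanSpace ℝ (Fin n))) p
  let B : ℕ → ContDiffBump (0 : EuclideanSpace ℝ (Fin n)) := fun k =>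
    ⟨1 / ((k : ℝ) + 1), 2 * (1 / ((k : ℝ) + 1)), by positivity, by
      have : (0 : ℝ) < 1 / ((k : ℝ) + 1) := by positivity
      linarith⟩
  have hψi : Integrable ψ := hψ.continuous.integrable_of_hasCompactSupport hψc
  have hgi : Integrable (Ω.indicator ψ) := hψi.indicator hΩ
  have hgc : HasCompactSupport (Ω.indicator ψ) := hψc.mono (by
    intro x hx h; apply hx; simp [h])
  have hB : Tendsto (fun i => (B i).rOut) atTop (𝓝 0) := by
    have := (tendsto_one_div_add_atTop_nhds_zero_nat (𝕜 := ℝ)).const_mul 2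
    rw [mul_zero] at this
    exact this
  have hlim := ContDiffBump.ae_convolution_tendsto_right_of_locallyIntegrable (μ := volume)
    (K := 2) hB (Eventually.of_forall fun i => le_rfl) hgi.locallyIntegrable
  set u : ℕ → EuclideanSpace ℝ (Fin n) → ℝ := fun k =>
    Ω.indicator ψ ⋆[ContinuousLinearMap.lsmul ℝ ℝ] (B k).normed volume with hu
  have hu1 : ∀ k, ContDiff ℝ 1 (u k) := by
    intro k
    have h1 : ContDiff ℝ 1 ((B k).normed (volume : Measure (EuclideanSpace ℝ (Fin n)))) :=
      (B k).contDiff_normed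
    exact_mod_cast (B k).hasCompactSupport_normed.contDiff_convolution_right (n := 1)
      (ContinuousLinearMap.lsmul ℝ ℝ) hgi.locallyIntegrable (by exact_mod_cast h1)
  have huc : ∀ k, HasCompactSupport (u k) := fun k =>
    hgc.convolution _ (B k).hasCompactSupport_normed
  have hbd : ∀ k, eLpNorm (u k) p volume ≤
      K * (relPerimeter Ω W + ∫⁻ x in Ω, ‖fderiv ℝ ψ x‖ₑ) := by
    intro k
    refine (eLpNorm_le_eLpNorm_fderiv_one volume (hu1 k) (huc k) hp').trans ?_
    gcongr
    rw [eLpNorm_one_eq_lintegral_enorm]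
    exact moll_grad_bound (B k).contDiff_normed (B k).hasCompactSupport_normed
      (B k).nonneg_normed (B k).integral_normed (B k).normed_neg hΩ hψ hψc hψ1 hψW
  refine (Lp.eLpNorm_lim_le_liminf_eLpNorm (f := u)
    (fun k => (hu1 k).continuous.aestronglyMeasurable) _ ?_).trans ?_
  · filter_upwards [hlim] with x hx
    refine hx.congr fun k => ?_
    simp only [hu]
    rw [← convolution_flip]
    congr 1
    ext
    simp
  · exact (liminf_le_liminf (Eventually.of_forall hbd)).trans (by simp)

theorem isoperim (n : ℕ) (hn : 2 ≤ n) : ∃ K : ℝ, 0 < K ∧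
    ∀ (Ω : Set (EuclideanSpace ℝ (Fin n))), MeasurableSet Ω →
    ∀ (x : EuclideanSpace ℝ (Fin n)) (a b : ℝ), 0 < a → a < b →
    volume (Ω ∩ ball x a) ^ (1 - (n : ℝ)⁻¹) ≤ ENNReal.ofReal K * (relPerimeter Ω (ball x b) +
      ENNReal.ofReal (b - a)⁻¹ * volume (Ω ∩ (ball x b \ ball x a))) := by
  have hn1 : (1 : ℝ≥0) < n := by exact_mod_cast hn
  have hp : NNReal.HolderConjugate (n : ℝ≥0) (NNReal.conjExponent n) :=
    NNReal.HolderConjugate.conjExponent hn1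
  set p := NNReal.conjExponent (n : ℝ≥0) with hpdef
  have hp0 : (p : ℝ≥0∞) ≠ 0 := by exact_mod_cast hp.symm.pos.ne'
  obtain ⟨K, hK⟩ := sobolev_indicator n hp
  obtain ⟨M, hM0, hM⟩ := exists_cutoff
  refine ⟨(K + 1) * (M + 1), by positivity, fun Ω hΩ x a b ha hab => ?_⟩
  obtain ⟨ψ, hψ, hψc, hψ1, hψa, hψb, hψd, hψ0⟩ := hM x a b ha hab
  have hba : 0 < b - a := by linarith
  have h1 := hK Ω (ball x b) hΩ ψ hψ hψc hψ1 hψb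
  have hpinv : 1 / (p : ℝ≥0∞).toReal = 1 - (n : ℝ)⁻¹ := by
    have := hp.coe.inv_add_inv_eq_one
    simp only [NNReal.coe_natCast] at this
    rw [ENNReal.coe_toReal, one_div]; linarith
  have h2 : volume (Ω ∩ ball x a) ^ (1 - (n : ℝ)⁻¹) ≤ eLpNorm (Ω.indicator ψ) p volume := by
    rw [← hpinv]
    have h3 := eLpNorm_indicator_const (μ := volume) (c := (1 : ℝ)) (hΩ.inter (measurableSet_ball (x := x) (ε := a)))
      hp0 ENNReal.coe_ne_top
    rw [enorm_one, one_mul] at h3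
    rw [← h3]
    refine eLpNorm_mono fun y => ?_
    by_cases hy : y ∈ Ω ∩ ball x a
    · rw [indicator_of_mem hy, indicator_of_mem hy.1, hψa y hy.2]
    · rw [indicator_of_notMem hy, norm_zero]; exact norm_nonneg _
  have h4 : ∫⁻ y in Ω, ‖fderiv ℝ ψ y‖ₑ ≤
      ENNReal.ofReal (M / (b - a)) * volume (Ω ∩ (ball x b \ ball x a)) := by
    have hm : MeasurableSet (ball x b \ ball x a) := measurableSet_ball.diff measurableSet_ball
    calc ∫⁻ y in Ω, ‖fderiv ℝ ψ y‖ₑ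
        ≤ ∫⁻ y in Ω, (ball x b \ ball x a).indicator (fun _ => ENNReal.ofReal (M / (b - a))) y := by
          refine lintegral_mono fun y => ?_
          by_cases hy : y ∈ ball x b \ ball x a
          · rw [indicator_of_mem hy, ← ofReal_norm]
            exact ENNReal.ofReal_le_ofReal (hψd y)
          · have : fderiv ℝ ψ y = 0 := by
              by_cases hya : y ∈ ball x a
              · exact hψ0 y hya
              · have hyb : y ∉ tsupport (fderiv ℝ ψ) := fun h =>
                  hy ⟨hψb (tsupport_fderiv_subset ℝ h), hya⟩
                exact image_eq_zero_of_notMem_tsupport hyb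
            have hz : ‖fderiv ℝ ψ y‖ₑ = 0 := by rw [← ofReal_norm, this]; simp
            rw [hz]; exact zero_le
      _ = _ := by
          rw [lintegral_indicator hm, setLIntegral_const, Measure.restrict_apply hm, inter_comm]
  refine h2.trans (h1.trans ?_)
  set P := relPerimeter Ω (ball x b)
  set V := volume (Ω ∩ (ball x b \ ball x a))
  calc (K : ℝ≥0∞) * (P + ∫⁻ y in Ω, ‖fderiv ℝ ψ y‖ₑ)
      ≤ ENNReal.ofReal (K + 1) * (ENNReal.ofReal (M + 1) * P +
          ENNReal.ofReal (M + 1) * (ENNReal.ofReal (b - a)⁻¹ * V)) := by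
        gcongr ?_ * (?_ + ?_)
        · rw [← ENNReal.ofReal_coe_nnreal]
          exact ENNReal.ofReal_le_ofReal (by linarith)
        · refine le_mul_of_one_le_left' ?_
          rw [← ENNReal.ofReal_one]
          exact ENNReal.ofReal_le_ofReal (by linarith)
        · refine h4.trans ?_
          rw [← mul_assoc, ← ENNReal.ofReal_mul (by positivity)]
          gcongr
          rw [div_eq_mul_inv]
          gcongr
          linarith
    _ = _ := by
        rw [← mul_add, ← mul_assoc, ← ENNReal.ofReal_mul (by positivity)]

theorem growth_contra {g : ℝ → ℝ} {lam K R : ℝ} (hlam : 1 < lam) (hK : 0 < K)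
    (hpos : ∀ r, 0 < r → r < R → 0 < g r)
    (hstep : ∀ r, 0 < r → r + 2 * (K * g r) < R → lam * g r ≤ g (r + 2 * (K * g r)))
    (hdens : ∀ δ, 0 < δ → ∃ R', 0 < R' ∧ R' ≤ R ∧ ∀ s, 0 < s → s < R' → g s ≤ δ * s) : False := by
  set L := 2 * K / (lam - 1) with hL
  have hl1 : 0 < lam - 1 := by linarith
  have hL0 : 0 < L := by positivity
  have hLK : L * lam = L + 2 * K := by rw [hL]; field_simp; ring
  set δ := 1 / (4 * L + 2 * K) with hδ
  have hδ0 : 0 < δ := by positivity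
  have hδL : L * δ ≤ 1 / 4 := by
    rw [hδ, mul_one_div, div_le_div_iff₀ (by positivity) (by norm_num)]; linarith
  have hδK : 2 * K * δ ≤ 1 := by
    rw [hδ, mul_one_div, div_le_one (by positivity)]; linarith
  obtain ⟨R', hR'0, hR'R, hR'⟩ := hdens δ hδ0
  let r : ℕ → ℝ := fun k => Nat.rec (R' / 4) (fun _ s => s + 2 * (K * g s)) k
  have hr0 : r 0 = R' / 4 := rfl
  have hrs : ∀ k, r (k + 1) = r k + 2 * (K * g (r k)) := fun k => rfl
  have hg0 : 0 < g (R' / 4) := hpos _ (by positivity) (by linarith)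
  have hinv : ∀ k, 0 < r k ∧ r k < R' ∧ r k ≤ R' / 4 + L * g (r k) ∧
      lam ^ k * g (R' / 4) ≤ g (r k) := by
    intro k
    induction k with
    | zero =>
      rw [hr0]
      refine ⟨by positivity, by linarith, ?_, by simp⟩
      have := mul_pos hL0 hg0
      linarith
    | succ k ih =>
      obtain ⟨h1, h2, h3, h4⟩ := ih
      have hgs := hR' _ h1 h2
      have hgp := hpos _ h1 (by linarith)
      have h5 : L * g (r k) ≤ 1 / 4 * r k := by
        calc L * g (r k) ≤ L * (δ * r k) := by gcongr
          _ = (L * δ) * r k := by ring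
          _ ≤ _ := by gcongr
      have h6 : 2 * (K * g (r k)) ≤ r k := by
        calc 2 * (K * g (r k)) ≤ 2 * (K * (δ * r k)) := by gcongr
          _ = (2 * K * δ) * r k := by ring
          _ ≤ 1 * r k := by gcongr
          _ = _ := one_mul _
      have h7 : r (k + 1) < R' := by rw [hrs]; linarith
      have h8 := hstep (r k) h1 (by rw [← hrs]; linarith)
      rw [← hrs] at h8
      have hKg : 0 < K * g (r k) := mul_pos hK hgp
      refine ⟨by rw [hrs]; linarith, h7, ?_, ?_⟩
      · have h9 : L * (lam * g (r k)) ≤ L * g (r (k + 1)) := by gcongr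
        have h10 : L * (lam * g (r k)) = L * g (r k) + 2 * (K * g (r k)) := by
          rw [← mul_assoc, hLK]; ring
        have h11 := hrs k
        linarith
      · rw [pow_succ]
        calc lam ^ k * lam * g (R' / 4) = lam * (lam ^ k * g (R' / 4)) := by ring
          _ ≤ lam * g (r k) := by gcongr
          _ ≤ _ := h8
  obtain ⟨k, hk⟩ := pow_unbounded_of_one_lt (δ * R' / g (R' / 4)) hlam
  obtain ⟨h1, h2, h3, h4⟩ := hinv k
  rw [div_lt_iff₀ hg0] at hk
  have h5 := hR' _ h1 h2
  have : δ * r k ≤ δ * R' := by gcongr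
  linarith

theorem not_density_one_of_null {n : ℕ} {Ω : Set (EuclideanSpace ℝ (Fin n))}
    {x y : EuclideanSpace ℝ (Fin n)} {r : ℝ} (h : volume (Ω ∩ ball x r) = 0) (hy : y ∈ ball x r) :
    y ∉ densityPts Ω 1 := by
  intro h1
  have h2 : Tendsto (fun s : ℝ => volume (Ω ∩ ball y s) / volume (ball y s)) (𝓝[>] 0) (𝓝 0) := by
    refine Tendsto.congr' ?_ tendsto_const_nhds
    rw [mem_ball] at hy
    have : Iio (r - dist y x) ∈ 𝓝[>] (0:ℝ) := mem_nhdsWithin_of_mem_nhds (Iio_mem_nhds (by linarith))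
    filter_upwards [this] with s hs
    have hsub : Ω ∩ ball y s ⊆ Ω ∩ ball x r :=
      inter_subset_inter_right _ (ball_subset_ball' (by have := mem_Iio.1 hs; linarith))
    rw [measure_mono_null hsub h, ENNReal.zero_div]
  exact zero_ne_one (tendsto_nhds_unique h2 h1)

theorem density_zero_bound {n : ℕ} {Ω : Set (EuclideanSpace ℝ (Fin n))}
    {x : EuclideanSpace ℝ (Fin n)} (hx : x ∈ densityPts Ω 0) {R c : ℝ} (hR : 0 < R) (hc : 0 < c) :
    ∃ R', 0 < R' ∧ R' ≤ R ∧ ∀ s, 0 < s → s < R' →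
      volume (Ω ∩ ball x s) ≤ ENNReal.ofReal c * volume (ball x s) := by
  have h1 : ∀ᶠ s in 𝓝[>] (0 : ℝ), volume (Ω ∩ ball x s) / volume (ball x s) < ENNReal.ofReal c :=
    (hx : Tendsto _ _ _).eventually_lt_const (by simpa using hc)
  rw [eventually_nhdsWithin_iff, Metric.eventually_nhds_iff] at h1
  obtain ⟨δ, hδ, h⟩ := h1
  refine ⟨min δ R, lt_min hδ hR, min_le_right _ _, fun s hs0 hs => ?_⟩
  have h2 := h (y := s) (by
    rw [Real.dist_0_eq_abs, abs_of_pos hs0]; exact hs.trans_le (min_le_left _ _)) hs0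
  have h3 : volume (ball x s) ≠ 0 := (measure_ball_pos volume x hs0).ne'
  have h4 : volume (ball x s) ≠ ⊤ := measure_ball_lt_top.ne
  exact (ENNReal.div_le_iff h3 h4).1 h2.le

theorem good_radius {n : ℕ} (hn : 2 ≤ n) {Ω : Set (EuclideanSpace ℝ (Fin n))}
    (hΩ : MeasurableSet Ω) (hP : perimeter Ω ≠ ⊤) {x : EuclideanSpace ℝ (Fin n)}
    (hx : x ∈ densityPts Ω 0) {η R : ℝ} (hη : 0 < η) (hR : 0 < R) :
    ∃ r, 0 < r ∧ r < R ∧ μH[(n : ℝ) - 1] (sphere x r ∩ densityPts Ω 1) ≤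
      ENNReal.ofReal η * relPerimeter Ω (ball x r) := by
  by_contra! hcon
  have hn0 : (0 : ℝ) < n := by positivity
  set V : Set (EuclideanSpace ℝ (Fin n)) → ℝ := fun S => (volume S).toReal with hV
  set f : ℝ → ℝ := fun r => V (Ω ∩ ball x r) with hf
  have hfin : ∀ r, volume (Ω ∩ ball x r) ≠ ⊤ := fun r =>
    ne_top_of_le_ne_top measure_ball_lt_top.ne (measure_mono inter_subset_right)
  have hf0 : ∀ r, 0 < r → r < R → 0 < f r := by
    intro r hr0 hrR
    refine ENNReal.toReal_pos ?_ (hfin r)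
    intro h0
    have h1 := hcon (r / 2) (by positivity) (by linarith)
    have h2 : sphere x (r / 2) ∩ densityPts Ω 1 = ∅ := by
      ext y
      simp only [mem_inter_iff, mem_empty_iff_false, iff_false, not_and]
      intro hy
      refine not_density_one_of_null h0 ?_
      rw [mem_sphere] at hy
      rw [mem_ball, hy]; linarith
    rw [h2] at h1
    simp at h1
  have hfm : ∀ {a b}, a ≤ b → f a ≤ f b := fun {a b} hab =>
    ENNReal.toReal_mono (hfin b) (measure_mono (inter_subset_inter_right _ (ball_subset_ball hab)))
  have hdiff : ∀ {a b}, a ≤ b → volume (Ω ∩ (ball x b \ ball x a)) =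
      ENNReal.ofReal (f b - f a) := by
    intro a b hab
    have h1 : Ω ∩ (ball x b \ ball x a) = (Ω ∩ ball x b) \ (Ω ∩ ball x a) := by
      ext y; simp only [mem_inter_iff, Set.mem_sdiff]; tauto
    rw [h1, measure_sdiff (inter_subset_inter_right _ (ball_subset_ball hab))
      (hΩ.inter measurableSet_ball).nullMeasurableSet (hfin a), ENNReal.ofReal_sub _ ENNReal.toReal_nonneg,
      ENNReal.ofReal_toReal (hfin b), ENNReal.ofReal_toReal (hfin a)]
  obtain ⟨K3, hK3⟩ := eilenberg_sphere n hn
  obtain ⟨K1, hK1, hiso⟩ := isoperim n hn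
  have hpf : ∀ r, relPerimeter Ω (ball x r) ≠ ⊤ := fun r =>
    ne_top_of_le_ne_top hP (relPerimeter_mono Ω (subset_univ _))
  set p : ℝ → ℝ := fun r => (relPerimeter Ω (ball x r)).toReal with hp
  have hA : ∀ b c, 0 < b → b < c → c < R → η * p b * (c - b) ≤ K3 * (f c - f b) := by
    intro b c hb hbc hcR
    set A := densityPts Ω 1 ∩ (ball x c \ closedBall x b) with hAdef
    have h1 : ENNReal.ofReal η * relPerimeter Ω (ball x b) * ENNReal.ofReal (c - b) ≤
        K3 * volume A := by
      refine le_trans ?_ (hK3 x A)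
      rw [← Real.volume_Ioo, ← setLIntegral_const]
      refine le_trans ?_ (setLIntegral_le_lintegral (Ioo b c) _)
      refine setLIntegral_mono' measurableSet_Ioo fun r hr => ?_
      have h2 : sphere x r ∩ densityPts Ω 1 ⊆ sphere x r ∩ A := by
        rintro y ⟨hy1, hy2⟩
        refine ⟨hy1, hy2, ?_, ?_⟩
        · rw [mem_ball, mem_sphere.1 hy1]; exact hr.2
        · rw [mem_closedBall, mem_sphere.1 hy1, not_le]; exact hr.1
      refine le_trans ?_ (measure_mono h2)
      refine le_trans ?_ (hcon r (hb.trans hr.1) (hr.2.trans hcR)).le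
      gcongr
      exact relPerimeter_mono Ω (ball_subset_ball hr.1.le)
    have h3 : volume A ≤ ENNReal.ofReal (f c - f b) := by
      rw [← hdiff hbc.le]
      calc volume A ≤ volume (Ω ∩ (ball x c \ ball x b) ∪ (densityPts Ω 1 \ Ω)) := by
            refine measure_mono ?_
            rintro y ⟨hy1, hy2, hy3⟩
            by_cases hy : y ∈ Ω
            · exact Or.inl ⟨hy, hy2, fun h => hy3 (ball_subset_closedBall h)⟩
            · exact Or.inr ⟨hy1, hy⟩
        _ ≤ _ := measure_union_le _ _
        _ = _ := by rw [volume_density_one_diff hn hΩ, add_zero]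
    have h4 : ENNReal.ofReal (η * p b * (c - b)) ≤ ENNReal.ofReal (K3 * (f c - f b)) := by
      rw [ENNReal.ofReal_mul (by positivity), ENNReal.ofReal_mul hη.le, ENNReal.ofReal_toReal (hpf b),
        ENNReal.ofReal_mul K3.coe_nonneg, ENNReal.ofReal_coe_nnreal]
      exact h1.trans (by gcongr)
    refine (ENNReal.ofReal_le_ofReal_iff ?_).1 h4
    exact mul_nonneg K3.coe_nonneg (sub_nonneg.2 (hfm hbc.le))
  have hB : ∀ a b, 0 < a → a < b → f a ^ (1 - (n : ℝ)⁻¹) ≤ K1 * (p b + (b - a)⁻¹ * (f b - f a)) := by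
    intro a b ha hab
    have hba : 0 < b - a := by linarith
    have h0 : 0 ≤ f b - f a := sub_nonneg.2 (hfm hab.le)
    have hp0 : 0 ≤ p b := ENNReal.toReal_nonneg
    have hf0 : 0 ≤ f a := ENNReal.toReal_nonneg
    have hex : 0 ≤ 1 - (n : ℝ)⁻¹ := by
      have : (n : ℝ)⁻¹ ≤ 1 := inv_le_one_of_one_le₀ (by exact_mod_cast (by omega : 1 ≤ n))
      linarith
    have h1 := hiso Ω hΩ x a b ha hab
    rw [hdiff hab.le] at h1
    refine (ENNReal.ofReal_le_ofReal_iff (by positivity)).1 ?_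
    rw [ENNReal.ofReal_mul hK1.le, ENNReal.ofReal_add hp0 (by positivity),
      ENNReal.ofReal_toReal (hpf b), ENNReal.ofReal_mul (by positivity),
      ← ENNReal.ofReal_rpow_of_nonneg hf0 hex, ENNReal.ofReal_toReal (hfin a)]
    exact h1
  set K := K1 * (K3 / η + 1) with hKdef
  have hK : 0 < K := by positivity
  have hC : ∀ r h, 0 < r → 0 < h → r + 2 * h < R →
      h * f r ^ (1 - (n : ℝ)⁻¹) ≤ K * (f (r + 2 * h) - f r) := by
    intro r h hr hh hR
    have h1 := hA (r + h) (r + 2 * h) (by positivity) (by linarith) hR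
    have h2 := hB r (r + h) hr (by linarith)
    rw [show r + 2 * h - (r + h) = h by ring] at h1
    rw [show r + h - r = h by ring] at h2
    have h3 : f r ≤ f (r + h) := hfm (by linarith)
    have h4 : f (r + h) ≤ f (r + 2 * h) := hfm (by linarith)
    have h5 : h * p (r + h) ≤ K3 / η * (f (r + 2 * h) - f (r + h)) := by
      rw [div_mul_eq_mul_div, le_div_iff₀ hη]; linarith
    have h6 : K3 / η * (f (r + 2 * h) - f (r + h)) ≤ K3 / η * (f (r + 2 * h) - f r) := by
      gcongr
    calc h * f r ^ (1 - (n : ℝ)⁻¹) ≤ h * (K1 * (p (r + h) + h⁻¹ * (f (r + h) - f r))) := by gcongr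
      _ = K1 * (h * p (r + h) + (f (r + h) - f r)) := by field_simp
      _ ≤ K1 * (K3 / η * (f (r + 2 * h) - f r) + (f (r + 2 * h) - f r)) := by
          refine mul_le_mul_of_nonneg_left ?_ hK1.le
          linarith
      _ = _ := by rw [hKdef]; ring
  set g : ℝ → ℝ := fun r => f r ^ (n : ℝ)⁻¹ with hg
  have hfn : ∀ r, 0 ≤ f r := fun r => ENNReal.toReal_nonneg
  refine growth_contra (g := g) (lam := 2 ^ (n : ℝ)⁻¹) (K := K) (R := R) ?_ hK ?_ ?_ ?_
  · exact Real.one_lt_rpow (by norm_num) (by positivity)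
  · intro r hr0 hrR
    exact Real.rpow_pos_of_pos (hf0 r hr0 hrR) _
  · intro r hr0 hrR
    have hrR' : r < R := by
      have : 0 ≤ K * g r := mul_nonneg hK.le (Real.rpow_nonneg (hfn r) _)
      linarith
    have hfr := hf0 r hr0 hrR'
    have hgr : 0 < g r := Real.rpow_pos_of_pos hfr _
    have h1 := hC r (K * g r) hr0 (by positivity) hrR
    have h2 : g r * f r ^ (1 - (n : ℝ)⁻¹) = f r := by
      rw [hg]; simp only
      rw [← Real.rpow_add hfr]; simp
    rw [mul_assoc, h2] at h1
    have h3 := le_of_mul_le_mul_left h1 hK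
    have h4 : 2 * f r ≤ f (r + 2 * (K * g r)) := by linarith
    calc (2 : ℝ) ^ (n : ℝ)⁻¹ * g r = (2 * f r) ^ (n : ℝ)⁻¹ := (Real.mul_rpow (by norm_num) (hfn r)).symm
      _ ≤ _ := Real.rpow_le_rpow (by have := hfn r; positivity) h4 (by positivity)
  · intro δ hδ
    set ω := (volume (ball (0 : EuclideanSpace ℝ (Fin n)) 1)).toReal with hω
    have hω0 : 0 < ω := ENNReal.toReal_pos (measure_ball_pos volume _ one_pos).ne'
      measure_ball_lt_top.ne
    obtain ⟨R', h1, h2, h3⟩ := density_zero_bound hx hR (c := δ ^ n / ω) (by positivity)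
    refine ⟨R', h1, h2, fun s hs0 hs => ?_⟩
    have h4 := h3 s hs0 hs
    rw [Measure.addHaar_ball_of_pos volume x hs0, finrank_euclideanSpace_fin] at h4
    have h5 : f s ≤ (δ * s) ^ n := by
      have h6 := ENNReal.toReal_mono (by finiteness) h4
      rw [ENNReal.toReal_mul, ENNReal.toReal_mul, ENNReal.toReal_ofReal (by positivity),
        ENNReal.toReal_ofReal (by positivity), ← hω] at h6
      refine h6.trans (le_of_eq ?_)
      rw [mul_pow]; field_simp
    calc g s ≤ ((δ * s) ^ n) ^ (n : ℝ)⁻¹ := Real.rpow_le_rpow (hfn s) h5 (by positivity)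
      _ = δ * s := Real.pow_rpow_inv_natCast (by positivity) (by omega)

/-- For `n ≥ 2` there is `C(n) > 0` such that for every bounded set of finite
perimeter `Ω ⊆ ℝⁿ` and every `ε ∈ (0,1)` there are countably many open balls `B j`, `j ∈ J`,
of radii `< ε` centered on `∂Ω ∩ Ω⁰`, covering `∂Ω ∩ Ω⁰`, with
`P(⋃ j, B j; Ω¹) = H^{n-1}(∂*(⋃ j, B j) ∩ Ω¹) ≤ C(n) ε` and `Σ_j |B j ∩ Ω| ≤ C(n) ε²`. -/
theorem exterior_boundary_ball_covering (n : ℕ) (hn : 2 ≤ n) :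
    ∃ C : ℝ≥0, 0 < C ∧
      ∀ Ω : Set (EuclideanSpace ℝ (Fin n)),
        Bornology.IsBounded Ω → MeasurableSet Ω → perimeter Ω ≠ ⊤ →
        ∀ ε : ℝ, 0 < ε → ε < 1 →
        ∃ (J : Set ℕ) (c : ℕ → EuclideanSpace ℝ (Fin n)) (ρ : ℕ → ℝ),
          (∀ j ∈ J, 0 < ρ j ∧ ρ j < ε ∧ c j ∈ frontier Ω ∩ densityPts Ω 0) ∧
          (frontier Ω ∩ densityPts Ω 0 ⊆ ⋃ j ∈ J, ball (c j) (ρ j)) ∧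
          μH[(n : ℝ) - 1] (essBoundary (⋃ j ∈ J, ball (c j) (ρ j)) ∩ densityPts Ω 1) ≤
            (C : ℝ≥0∞) * ENNReal.ofReal ε ∧
          ∑' j : J, volume (ball (c j) (ρ j) ∩ Ω) ≤ (C : ℝ≥0∞) * ENNReal.ofReal (ε ^ 2) := by
  obtain ⟨N, τ, hτ, hN⟩ :=
    HasBesicovitchCovering.no_satelliteConfig (α := EuclideanSpace ℝ (Fin n))
  refine ⟨(N : ℝ≥0) + 1, by positivity, fun Ω hΩb hΩ hP ε hε hε1 => ?_⟩
  set F := frontier Ω ∩ densityPts Ω 0 with hF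
  have hΩfin : volume Ω ≠ ⊤ := hΩb.measure_lt_top.ne
  -- the open neighbourhood of `F`
  obtain ⟨O, hFO, hO, hOvol⟩ : ∃ O, F ⊆ O ∧ IsOpen O ∧
      volume (O ∩ Ω) < ENNReal.ofReal (ε ^ 2) := by
    have : IsFiniteMeasure (volume.restrict Ω) := ⟨by
      rw [Measure.restrict_apply_univ]; exact hΩfin.lt_top⟩
    have h0 : volume.restrict Ω F = 0 := by
      rw [Measure.restrict_apply' hΩ]
      exact measure_mono_null (inter_subset_inter_left _ inter_subset_right)
        (volume_density_zero_inter hn hΩ)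
    obtain ⟨O, h1, h2, h3⟩ := Set.exists_isOpen_lt_of_lt (μ := volume.restrict Ω) F
      (ENNReal.ofReal (ε ^ 2)) (by rw [h0]; exact ENNReal.ofReal_pos.2 (by positivity))
    rw [Measure.restrict_apply' hΩ] at h3
    exact ⟨O, h1, h2, h3⟩
  set P := (perimeter Ω).toReal with hPdef
  have hP0 : 0 ≤ P := ENNReal.toReal_nonneg
  set η := ε / (P + 1) with hη
  have hη0 : 0 < η := by positivity
  have hηP : ENNReal.ofReal η * perimeter Ω ≤ ENNReal.ofReal ε := by
    rw [← ENNReal.ofReal_toReal hP, ← ENNReal.ofReal_mul hη0.le]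
    refine ENNReal.ofReal_le_ofReal ?_
    rw [hη, ← hPdef, div_mul_eq_mul_div, div_le_iff₀ (by positivity)]
    nlinarith
  -- choice of the radii
  have hrad : ∀ x : F, ∃ r : ℝ, 0 < r ∧ r < ε ∧ ball (x : EuclideanSpace ℝ (Fin n)) r ⊆ O ∧
      2 * volume (Ω ∩ ball (x : EuclideanSpace ℝ (Fin n)) r) ≤
        volume (ball (x : EuclideanSpace ℝ (Fin n)) r) ∧
      μH[(n : ℝ) - 1] (sphere (x : EuclideanSpace ℝ (Fin n)) r ∩ densityPts Ω 1) ≤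
        ENNReal.ofReal η * relPerimeter Ω (ball (x : EuclideanSpace ℝ (Fin n)) r) := by
    rintro ⟨x, hx⟩
    obtain ⟨δ, hδ, hδO⟩ := Metric.isOpen_iff.1 hO x (hFO hx)
    obtain ⟨R', h1, h2, h3⟩ := density_zero_bound hx.2 (lt_min hδ hε) (c := 1 / 2) (by norm_num)
    obtain ⟨r, hr0, hrR, hr⟩ := good_radius hn hΩ hP hx.2 hη0 h1
    have h4 := hrR.trans_le h2
    refine ⟨r, hr0, h4.trans_le (min_le_right _ _),
      (ball_subset_ball (h4.trans_le (min_le_left _ _)).le).trans hδO, ?_, hr⟩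
    calc 2 * volume (Ω ∩ ball x r) ≤ 2 * (ENNReal.ofReal (1 / 2) * volume (ball x r)) := by
          gcongr; exact h3 r hr0 hrR
      _ = volume (ball x r) := by
          have h2 : (2 : ℝ≥0∞) * ENNReal.ofReal (1 / 2) = 1 := by
            rw [show (2 : ℝ≥0∞) = ENNReal.ofReal 2 by simp, ← ENNReal.ofReal_mul (by norm_num)]
            norm_num
          rw [← mul_assoc, h2, one_mul]
  choose ρ hρ0 hρε hρO hρhalf hρgood using hrad
  let q : Besicovitch.BallPackage F (EuclideanSpace ℝ (Fin n)) :=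
    { c := Subtype.val
      r := ρ
      rpos := hρ0
      r_bound := ε
      r_le := fun b => (hρε b).le }
  obtain ⟨s, hs, hcov⟩ := Besicovitch.exist_disjoint_covering_families hτ hN q
  replace hs : ∀ i, (s i).PairwiseDisjoint
    fun j : F => closedBall (j : EuclideanSpace ℝ (Fin n)) (ρ j) := hs
  replace hcov : F ⊆ ⋃ i, ⋃ j ∈ s i, ball (j : EuclideanSpace ℝ (Fin n)) (ρ j) := by
    have : range q.c = F := Subtype.range_coe
    rw [this] at hcov; exact hcov
  have hsb : ∀ i, (s i).PairwiseDisjoint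
      fun j : F => ball (j : EuclideanSpace ℝ (Fin n)) (ρ j) := fun i j hj k hk hjk =>
    (hs i hj hk hjk).mono ball_subset_closedBall ball_subset_closedBall
  have hscount : ∀ i, (s i).Countable := fun i =>
    (hsb i).countable_of_isOpen (fun j _ => isOpen_ball) fun j _ => nonempty_ball.2 (hρ0 j)
  set S : Set F := ⋃ i, s i with hS
  have hScount : S.Countable := countable_iUnion hscount
  have : Countable S := hScount.to_subtype
  obtain ⟨e, he⟩ := exists_injective_nat S
  set c' : ℕ → EuclideanSpace ℝ (Fin n) := Function.extend e (fun j => (j.1 : EuclideanSpace ℝ (Fin n)))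
    (fun _ => 0) with hc'
  set ρ' : ℕ → ℝ := Function.extend e (fun j => ρ j.1) (fun _ => 0) with hρ'
  have hce : ∀ j, c' (e j) = j.1 := fun j => he.extend_apply _ _ _
  have hρe : ∀ j, ρ' (e j) = ρ j.1 := fun j => he.extend_apply _ _ _
  have hU : ⋃ j ∈ range e, ball (c' j) (ρ' j) =
      ⋃ i, ⋃ j ∈ s i, ball (j : EuclideanSpace ℝ (Fin n)) (ρ j) := by
    rw [biUnion_range]
    simp only [hce, hρe]
    ext y
    simp only [mem_iUnion]
    constructor
    · rintro ⟨⟨j, hj⟩, hy⟩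
      obtain ⟨i, hi⟩ := mem_iUnion.1 hj
      exact ⟨i, j, hi, hy⟩
    · rintro ⟨i, j, hi, hy⟩
      exact ⟨⟨j, mem_iUnion.2 ⟨i, hi⟩⟩, hy⟩
  refine ⟨range e, c', ρ', ?_, ?_, ?_, ?_⟩
  · rintro _ ⟨j, rfl⟩
    rw [hce, hρe]
    exact ⟨hρ0 _, hρε _, j.1.2⟩
  · rw [hU]; exact hcov
  · rw [hU]
    have hD : volume (Metric.thickening 1 (closure Ω)) ≠ ⊤ :=
      (hΩb.closure.thickening).measure_lt_top.ne
    have hsub := essBoundary_inter_subset hΩ hD s (fun j : F => (j : EuclideanSpace ℝ (Fin n))) ρ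
      hρ0 hs hρhalf (by
        intro j y hy
        rw [Metric.mem_thickening_iff]
        exact ⟨j, frontier_subset_closure j.2.1, (mem_ball.1 hy).trans ((hρε j).trans hε1)⟩)
    have hsub' : essBoundary (⋃ i, ⋃ j ∈ s i, ball (j : EuclideanSpace ℝ (Fin n)) (ρ j)) ∩
        densityPts Ω 1 ⊆ ⋃ i, ⋃ j ∈ s i,
          (sphere (j : EuclideanSpace ℝ (Fin n)) (ρ j) ∩ densityPts Ω 1) := by
      intro y hy
      have h1 := hsub hy
      simp only [mem_iUnion] at h1 ⊢
      obtain ⟨i, j, hj, hyj⟩ := h1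
      exact ⟨i, j, hj, hyj, hy.2⟩
    calc μH[(n : ℝ) - 1] (essBoundary (⋃ i, ⋃ j ∈ s i,
          ball (j : EuclideanSpace ℝ (Fin n)) (ρ j)) ∩ densityPts Ω 1)
        ≤ μH[(n : ℝ) - 1] (⋃ i, ⋃ j ∈ s i,
          (sphere (j : EuclideanSpace ℝ (Fin n)) (ρ j) ∩ densityPts Ω 1)) := measure_mono hsub'
      _ ≤ ∑ i, μH[(n : ℝ) - 1] (⋃ j ∈ s i,
          (sphere (j : EuclideanSpace ℝ (Fin n)) (ρ j) ∩ densityPts Ω 1)) :=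
          measure_iUnion_fintype_le _ _
      _ ≤ ∑ _i : Fin N, ENNReal.ofReal ε := by
          refine Finset.sum_le_sum fun i _ => ?_
          calc _ ≤ ∑' j : s i, μH[(n : ℝ) - 1]
                (sphere ((j : F) : EuclideanSpace ℝ (Fin n)) (ρ j) ∩ densityPts Ω 1) :=
                measure_biUnion_le _ (hscount i) _
            _ ≤ ∑' j : s i, ENNReal.ofReal η *
                relPerimeter Ω (ball ((j : F) : EuclideanSpace ℝ (Fin n)) (ρ j)) :=
                ENNReal.tsum_le_tsum fun j => hρgood j
            _ = ENNReal.ofReal η * ∑' j : s i,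
                relPerimeter Ω (ball ((j : F) : EuclideanSpace ℝ (Fin n)) (ρ j)) :=
                ENNReal.tsum_mul_left
            _ ≤ ENNReal.ofReal η * perimeter Ω := by
                gcongr
                exact sum_relPerimeter_le Ω (s i)
                  (fun j : F => ball (j : EuclideanSpace ℝ (Fin n)) (ρ j)) (hsb i)
            _ ≤ _ := hηP
      _ = N * ENNReal.ofReal ε := by simp
      _ ≤ _ := by
          gcongr
          push_cast
          exact le_self_add
  · rw [tsum_range (fun j => volume (ball (c' j) (ρ' j) ∩ Ω)) he]
    simp only [hce, hρe]
    calc ∑' j : S, volume (ball ((j : F) : EuclideanSpace ℝ (Fin n)) (ρ j) ∩ Ω)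
        ≤ ∑ i, ∑' j : s i, volume (ball ((j : F) : EuclideanSpace ℝ (Fin n)) (ρ j) ∩ Ω) :=
          ENNReal.tsum_iUnion_le
            (fun j : F => volume (ball (j : EuclideanSpace ℝ (Fin n)) (ρ j) ∩ Ω)) s
      _ ≤ ∑ _i : Fin N, ENNReal.ofReal (ε ^ 2) := by
          refine Finset.sum_le_sum fun i _ => ?_
          rw [← measure_biUnion (hscount i)
            (f := fun j : F => ball (j : EuclideanSpace ℝ (Fin n)) (ρ j) ∩ Ω)
            (fun j hj k hk hjk => (hsb i hj hk hjk).mono inter_subset_left inter_subset_left)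
            (fun j _ => measurableSet_ball.inter hΩ)]
          refine (measure_mono ?_).trans hOvol.le
          exact iUnion₂_subset fun j _ => inter_subset_inter_left _ (hρO j)
      _ = N * ENNReal.ofReal (ε ^ 2) := by simp
      _ ≤ _ := by
          gcongr
          push_cast
          exact le_self_add
end
end

section
/- Let n ≥ 2, let Ω ⊂ ℝⁿ be a bounded set of finite perimeter, and let E ⊆ ℝⁿ be a set of finite perimeter with E ⋐ Ω. There exists a constant C₁(n) > 0 depending only on n such that for every x ∈ ℝⁿ and Lebesgue-almost every r > 0 satisfying 1/3 < |(Ω \ E) ∩ B_r(x)|/(ω_n rⁿ) < 1/2 (where ω_n is the volume of the n-dimensional unit ball), one has r^{n−1} ≤ C₁(n)·(P(E; B_r(x)) + P(Ω; B_r(x))). -/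
open MeasureTheory Metric Filter Set
open scoped ENNReal Topology NNReal

noncomputable section

/-- Testing the relative perimeter with a translated scalar bump times a fixed direction. -/
lemma vdiv_smul_const {n : ℕ} (g : EuclideanSpace ℝ (Fin n) → ℝ) (hg : ContDiff ℝ 1 g)
    (v e x : EuclideanSpace ℝ (Fin n)) :
    vdiv (fun y => g (y - v) • e) x = fderiv ℝ g (x - v) e := by
  have hd : HasFDerivAt g (fderiv ℝ g (x - v)) (x - v) :=
    (hg.differentiable one_ne_zero _).hasFDerivAt
  have h1 : HasFDerivAt (fun y => g (y - v)) (fderiv ℝ g (x - v)) x := by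
    have h0 := hd.comp x ((hasFDerivAt_id x).sub_const v)
    rw [ContinuousLinearMap.comp_id] at h0
    exact h0
  have h2 := h1.smul_const e
  unfold vdiv
  rw [h2.fderiv]
  have he : e = ∑ i, e i • EuclideanSpace.single i (1 : ℝ) := by
    ext j
    simp [Finset.sum_apply, Pi.single_apply]
  conv_rhs => rw [he, map_sum]
  refine Finset.sum_congr rfl fun i _ => ?_
  simp [mul_comm]

lemma translate_bound {n : ℕ} (F : Set (EuclideanSpace ℝ (Fin n)))
    (hFfin : volume F ≠ ⊤) (x₀ : EuclideanSpace ℝ (Fin n)) (r : ℝ)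
    (hP : relPerimeter F (ball x₀ r) ≠ ⊤)
    (g : EuclideanSpace ℝ (Fin n) → ℝ) (hg : ContDiff ℝ 1 g) (hgc : HasCompactSupport g)
    (hg01 : ∀ x, g x ∈ Icc (0 : ℝ) 1) (h : EuclideanSpace ℝ (Fin n))
    (hs : ∀ x ∈ tsupport g, x ∈ ball x₀ r ∧ x + h ∈ ball x₀ r) :
    ∫ x in F, (g x - g (x - h)) ≤ ‖h‖ * (relPerimeter F (ball x₀ r)).toReal := by
  set P := (relPerimeter F (ball x₀ r)).toReal with hPdef
  have hdc : Continuous (fderiv ℝ g) := hg.continuous_fderiv one_ne_zero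
  -- fundamental theorem of calculus
  have ftc : ∀ x, g x - g (x - h) = ∫ t in (0 : ℝ)..1, fderiv ℝ g (x - t • h) h := by
    intro x
    have hder : ∀ t ∈ uIcc (0 : ℝ) 1,
        HasDerivAt (fun t : ℝ => - g (x - t • h)) (fderiv ℝ g (x - t • h) h) t := by
      intro t _
      have hd : HasFDerivAt g (fderiv ℝ g (x - t • h)) (x - t • h) :=
        (hg.differentiable one_ne_zero _).hasFDerivAt
      have h1 : HasDerivAt (fun t : ℝ => x - t • h) (-h) t := by
        simpa using ((hasDerivAt_id t).smul_const h).const_sub x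
      have := (hd.comp_hasDerivAt t h1).neg
      rw [map_neg, neg_neg] at this
      exact this
    rw [intervalIntegral.integral_eq_sub_of_hasDerivAt hder]
    · simp; ring
    · apply Continuous.intervalIntegrable
      fun_prop
  -- each slice
  have slice : ∀ t ∈ Icc (0 : ℝ) 1, ∫ x in F, fderiv ℝ g (x - t • h) h ≤ ‖h‖ * P := by
    intro t ht
    set e := ‖h‖⁻¹ • h with he
    have hhe : h = ‖h‖ • e := by
      rcases eq_or_ne h 0 with h0 | h0
      · simp [h0]
      · rw [he, smul_smul, mul_inv_cancel₀ (norm_ne_zero_iff.2 h0), one_smul]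
    have hen : ‖e‖ ≤ 1 := by
      rw [he, norm_smul, norm_inv, norm_norm]
      exact inv_mul_le_one
    have hsub : tsupport (fun y => g (y - t • h) • e) ⊆ (fun y => y - t • h) ⁻¹' tsupport g := by
      apply closure_minimal
      · intro y hy
        apply subset_tsupport
        intro h0
        apply hy
        simp [h0]
      · exact (isClosed_tsupport g).preimage (by fun_prop)
    have hcomp : IsCompact ((fun y => y - t • h) ⁻¹' tsupport g) :=
      (Homeomorph.subRight (t • h)).isCompact_preimage.2 hgc
    have hle : ENNReal.ofReal (∫ x in F, vdiv (fun y => g (y - t • h) • e) x)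
        ≤ relPerimeter F (ball x₀ r) := by
      unfold relPerimeter
      refine le_iSup_of_le (fun y => g (y - t • h) • e) ?_
      refine le_iSup_of_le (by fun_prop) ?_
      refine le_iSup_of_le (hcomp.of_isClosed_subset (isClosed_tsupport _) hsub) ?_
      refine le_iSup_of_le ?_ ?_
      · intro y hy
        have hy' := hs _ (hsub hy)
        have hc := convex_ball x₀ r
        have := hc hy'.1 hy'.2 (sub_nonneg.2 ht.2) ht.1 (by ring)
        convert this using 1
        module
      · refine le_iSup_of_le ?_ le_rfl
        intro y
        rw [norm_smul, Real.norm_eq_abs, abs_of_nonneg (hg01 _).1]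
        exact mul_le_one₀ (hg01 _).2 (norm_nonneg _) hen
    have hle' : ∫ x in F, vdiv (fun y => g (y - t • h) • e) x ≤ P :=
      (ENNReal.ofReal_le_iff_le_toReal hP).1 hle
    have heq : ∀ x, fderiv ℝ g (x - t • h) h = ‖h‖ * vdiv (fun y => g (y - t • h) • e) x := by
      intro x
      rw [vdiv_smul_const g hg]
      conv_lhs => rw [hhe]
      rw [map_smul, smul_eq_mul, ← hhe]
    simp_rw [heq]
    rw [integral_const_mul]
    exact mul_le_mul_of_nonneg_left hle' (norm_nonneg _)
  -- Fubini
  obtain ⟨M, hM⟩ := (hgc.fderiv (𝕜 := ℝ)).exists_bound_of_continuous hdc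
  have : IsFiniteMeasure (volume.restrict F) := ⟨by simpa using hFfin.lt_top⟩
  have hfub : Integrable (Function.uncurry
      fun (x : EuclideanSpace ℝ (Fin n)) (t : ℝ) => fderiv ℝ g (x - t • h) h)
      ((volume.restrict F).prod (volume.restrict (Ioc (0 : ℝ) 1))) := by
    have hcont : Continuous (Function.uncurry
      fun (x : EuclideanSpace ℝ (Fin n)) (t : ℝ) => fderiv ℝ g (x - t • h) h) := by
      unfold Function.uncurry
      fun_prop
    refine Integrable.of_bound (C := M * ‖h‖) hcont.aestronglyMeasurable (ae_of_all _ ?_)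
    rintro ⟨x, t⟩
    exact ((fderiv ℝ g (x - t • h)).le_opNorm h).trans
      (mul_le_mul_of_nonneg_right (hM _) (norm_nonneg _))
  simp_rw [ftc, intervalIntegral.integral_of_le zero_le_one]
  rw [integral_integral_swap hfub]
  calc ∫ t in Ioc (0 : ℝ) 1, ∫ x in F, fderiv ℝ g (x - t • h) h
      ≤ ∫ t in Ioc (0 : ℝ) 1, ‖h‖ * P := by
        refine setIntegral_mono_on hfub.integral_prod_right ?_ measurableSet_Ioc ?_
        · exact integrable_const _
        · intro t ht
          exact slice t ⟨ht.1.le, ht.2⟩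
    _ = ‖h‖ * P := by simp

lemma crossing_bound {n : ℕ} (F : Set (EuclideanSpace ℝ (Fin n))) (hF : MeasurableSet F)
    (hFfin : volume F ≠ ⊤) (x₀ : EuclideanSpace ℝ (Fin n)) (r : ℝ)
    (hP : relPerimeter F (ball x₀ r) ≠ ⊤) (h : EuclideanSpace ℝ (Fin n)) :
    volume ((F ∩ ball x₀ r) ∩ (fun x => x + h) ⁻¹' (ball x₀ r \ F))
      ≤ ENNReal.ofReal ‖h‖ * relPerimeter F (ball x₀ r) := by
  set G := (F ∩ ball x₀ r) ∩ (fun x => x + h) ⁻¹' (ball x₀ r \ F) with hG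
  have hGm : MeasurableSet G :=
    (hF.inter measurableSet_ball).inter ((measurable_add_const h) (measurableSet_ball.diff hF))
  have hGfin : volume G ≠ ⊤ :=
    measure_ne_top_of_subset (inter_subset_left.trans inter_subset_left) hFfin
  set U := ball x₀ r ∩ (fun x => x + h) ⁻¹' ball x₀ r with hU
  have hUo : IsOpen U := isOpen_ball.inter (isOpen_ball.preimage (by fun_prop))
  have hGU : G ⊆ U := fun x hx => ⟨hx.1.2, hx.2.1⟩
  have key : ∀ ε : ℝ, 0 < ε → (volume G).toReal ≤
      ‖h‖ * (relPerimeter F (ball x₀ r)).toReal + (ε + ε) := by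
    intro ε hε
    have hε' : ENNReal.ofReal ε ≠ 0 := by simpa using hε
    obtain ⟨K, hKG, hK, hGK⟩ := hGm.exists_isCompact_lt_add hGfin hε'
    have hKfin : volume K ≠ ⊤ := hK.measure_ne_top
    obtain ⟨V, hKV, hVo, hVK⟩ := hK.exists_isOpen_lt_add (μ := volume) hε'
    obtain ⟨L, hL, hKL, hLV⟩ := exists_compact_between hK (hVo.inter hUo)
      (subset_inter hKV (hKG.trans hGU))
    obtain ⟨f, hf1, hf0, hf⟩ := exists_contMDiffMap_one_nhds_of_subset_interior
      (n := 1) (modelWithCornersSelf ℝ (EuclideanSpace ℝ (Fin n))) hK.isClosed hKL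
    obtain ⟨g, hgdef⟩ : ∃ g : EuclideanSpace ℝ (Fin n) → ℝ, g = f := ⟨_, rfl⟩
    have hg : ContDiff ℝ 1 g := by
      rw [hgdef]; exact f.contMDiff.contDiff
    have hg01 : ∀ x, g x ∈ Icc (0 : ℝ) 1 := by rw [hgdef]; exact hf
    have hg0 : ∀ x ∉ L, g x = 0 := by rw [hgdef]; exact hf0
    have hg1 : ∀ x ∈ K, g x = 1 := by rw [hgdef]; exact fun x hx => hf1.self_of_nhdsSet x hx
    have hts : tsupport g ⊆ L := by
      apply closure_minimal _ hL.isClosed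
      intro x hx
      by_contra hxL
      exact hx (hg0 x hxL)
    have hgc : HasCompactSupport g := hL.of_isClosed_subset (isClosed_tsupport g) hts
    have hb := translate_bound F hFfin x₀ r hP g hg hgc hg01 h
      (fun x hx => ⟨(hLV (hts hx)).2.1, (hLV (hts hx)).2.2⟩)
    have hgi : Integrable g := hg.continuous.integrable_of_hasCompactSupport hgc
    have hgi' : Integrable (fun x => g (x - h)) := hgi.comp_sub_right h
    rw [integral_sub hgi.integrableOn hgi'.integrableOn] at hb
    have hlow : (volume K).toReal ≤ ∫ x in F, g x := by
      have h1 : ∫ x in K, g x = (volume K).toReal := by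
        rw [setIntegral_congr_fun hK.measurableSet (g := fun _ => (1 : ℝ)) (fun x hx => hg1 x hx)]
        simp [Measure.real]
      rw [← h1]
      exact setIntegral_mono_set hgi.integrableOn (ae_of_all _ fun x => (hg01 x).1)
        (LE.le.eventuallyLE (fun x hx => (hKG hx).1.1))
    have hVKlt : volume (V \ K) ≤ ENNReal.ofReal ε := by
      rw [measure_sdiff hKV hK.measurableSet.nullMeasurableSet hKfin]
      exact tsub_le_iff_left.2 hVK.le
    set S := (fun x : EuclideanSpace ℝ (Fin n) => x - h) ⁻¹' (V \ K) with hS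
    have hSm : MeasurableSet S :=
      (measurable_sub_const h) (hVo.measurableSet.diff hK.measurableSet)
    have hSv : volume S = volume (V \ K) := by
      rw [hS]; simp only [sub_eq_add_neg]; exact measure_preimage_add_right volume (-h) (V \ K)
    have hSfin : volume S ≠ ⊤ := ne_top_of_le_ne_top ENNReal.ofReal_ne_top (hSv.le.trans hVKlt)
    have hup : ∫ x in F, g (x - h) ≤ ε := by
      calc ∫ x in F, g (x - h) ≤ ∫ x in F, S.indicator (fun _ => (1 : ℝ)) x := by
            refine setIntegral_mono_on hgi'.integrableOn ?_ hF ?_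
            · exact ((integrable_indicator_iff hSm).2
                (integrableOn_const hSfin)).integrableOn
            · intro x hx
              by_cases hxS : x ∈ S
              · rw [indicator_of_mem hxS]; exact (hg01 _).2
              · rw [indicator_of_notMem hxS]
                apply le_of_eq
                by_contra hne
                apply hxS
                have hxL : x - h ∈ L := by
                  by_contra hc; exact hne (hg0 _ hc)
                refine ⟨(hLV hxL).1, fun hxK => ?_⟩
                have := (hKG hxK).2.2
                simp at this
                exact this hx
        _ ≤ ∫ x, S.indicator (fun _ => (1 : ℝ)) x := by
            refine setIntegral_le_integral ((integrable_indicator_iff hSm).2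
                (integrableOn_const hSfin)) (ae_of_all _ fun x => ?_)
            exact indicator_nonneg (fun _ _ => zero_le_one) x
        _ = (volume S).toReal := by
            rw [integral_indicator hSm]; simp [Measure.real]
        _ ≤ ε := by
            rw [hSv]; exact ENNReal.toReal_le_of_le_ofReal hε.le hVKlt
    have hGK' : (volume G).toReal ≤ (volume K).toReal + ε := by
      have := ENNReal.toReal_mono (by finiteness) hGK.le
      rwa [ENNReal.toReal_add hKfin ENNReal.ofReal_ne_top, ENNReal.toReal_ofReal hε.le] at this
    linarith
  have hfin : (volume G).toReal ≤ ‖h‖ * (relPerimeter F (ball x₀ r)).toReal := by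
    refine le_of_forall_pos_le_add fun ε hε => ?_
    have := key (ε / 2) (half_pos hε)
    linarith
  rw [← ENNReal.ofReal_toReal hGfin, ← ENNReal.ofReal_toReal hP,
    ← ENNReal.ofReal_mul (norm_nonneg _)]
  exact ENNReal.ofReal_le_ofReal hfin

lemma poincare_set {n : ℕ} (F : Set (EuclideanSpace ℝ (Fin n))) (hF : MeasurableSet F)
    (hFfin : volume F ≠ ⊤) (x₀ : EuclideanSpace ℝ (Fin n)) (r : ℝ)
    (hP : relPerimeter F (ball x₀ r) ≠ ⊤) :
    volume (F ∩ ball x₀ r) * volume (ball x₀ r \ F) ≤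
      ENNReal.ofReal (2 * r) * relPerimeter F (ball x₀ r) *
        volume (ball (0 : EuclideanSpace ℝ (Fin n)) (2 * r)) := by
  set A := F ∩ ball x₀ r with hA
  set B := ball x₀ r \ F with hB
  have hAm : MeasurableSet A := hF.inter measurableSet_ball
  have hBm : MeasurableSet B := measurableSet_ball.diff hF
  have hdist : ∀ h, (volume (A ∩ (fun x => x + h) ⁻¹' B)) ≤
      (ball (0 : EuclideanSpace ℝ (Fin n)) (2 * r)).indicator
        (fun _ => ENNReal.ofReal (2 * r) * relPerimeter F (ball x₀ r)) h := by
    intro h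
    by_cases hh : h ∈ ball (0 : EuclideanSpace ℝ (Fin n)) (2 * r)
    · rw [indicator_of_mem hh]
      refine (crossing_bound F hF hFfin x₀ r hP h).trans ?_
      gcongr
      simpa using (mem_ball_zero_iff.1 hh).le
    · rw [indicator_of_notMem hh]
      have : A ∩ (fun x => x + h) ⁻¹' B = ∅ := by
        rw [eq_empty_iff_forall_notMem]
        rintro x ⟨hx, hxB⟩
        apply hh
        have h1 : dist x x₀ < r := hx.2
        have h2 : dist (x + h) x₀ < r := hxB.1
        have h3 : dist (x + h) x ≤ dist (x + h) x₀ + dist x x₀ := dist_triangle_right _ _ _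
        rw [mem_ball_zero_iff]
        have h4 : dist (x + h) x = ‖h‖ := by simp [dist_eq_norm]
        linarith
      rw [this]; simp
  have hswap : ∫⁻ h, volume (A ∩ (fun x => x + h) ⁻¹' B) = volume A * volume B := by
    have h1 : ∀ h : EuclideanSpace ℝ (Fin n), volume (A ∩ (fun x => x + h) ⁻¹' B) =
        ∫⁻ x, A.indicator 1 x * B.indicator (1 : EuclideanSpace ℝ (Fin n) → ℝ≥0∞) (x + h) := by
      intro h
      rw [← lintegral_indicator_one (hAm.inter ((measurable_add_const h) hBm))]
      congr 1
      ext x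
      rw [inter_indicator_one]
      rfl
    simp_rw [h1]
    rw [lintegral_lintegral_swap]
    · have h2 : ∀ x : EuclideanSpace ℝ (Fin n),
          ∫⁻ h, A.indicator 1 x * B.indicator (1 : EuclideanSpace ℝ (Fin n) → ℝ≥0∞) (x + h)
          = A.indicator 1 x * volume B := by
        intro x
        have hm : Measurable fun h : EuclideanSpace ℝ (Fin n) =>
            B.indicator (1 : EuclideanSpace ℝ (Fin n) → ℝ≥0∞) (x + h) :=
          (measurable_one.indicator hBm).comp (measurable_const_add x)
        rw [lintegral_const_mul _ hm,
          lintegral_add_left_eq_self (fun h => B.indicator (1 : EuclideanSpace ℝ (Fin n) → ℝ≥0∞) h) x,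
          lintegral_indicator_one hBm]
      simp_rw [h2]
      rw [lintegral_mul_const _ (measurable_one.indicator hAm), lintegral_indicator_one hAm]
    · apply Measurable.aemeasurable
      apply Measurable.mul
      · exact (measurable_one.indicator hAm).comp measurable_snd
      · exact (measurable_one.indicator hBm).comp (measurable_snd.add measurable_fst)
  rw [← hswap]
  refine (lintegral_mono hdist).trans ?_
  rw [lintegral_indicator measurableSet_ball, setLIntegral_const]

lemma vdiv_neg' {n : ℕ} (φ : EuclideanSpace ℝ (Fin n) → EuclideanSpace ℝ (Fin n))
    (x : EuclideanSpace ℝ (Fin n)) : vdiv (fun y => - φ y) x = - vdiv φ x := by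
  unfold vdiv
  rw [fderiv_fun_neg]
  simp

lemma relPerimeter_diff_le {n : ℕ} (Ω E W : Set (EuclideanSpace ℝ (Fin n)))
    (hE : MeasurableSet E) (hEΩ : E ⊆ Ω) :
    relPerimeter (Ω \ E) W ≤ relPerimeter E W + relPerimeter Ω W := by
  conv_lhs => unfold relPerimeter
  refine iSup_le fun φ => iSup_le fun h1 => iSup_le fun h2 => iSup_le fun h3 => iSup_le fun h4 => ?_
  have hc : Continuous (vdiv φ) := by
    have := h1.continuous_fderiv one_ne_zero
    unfold vdiv
    fun_prop
  have hcs : HasCompactSupport (vdiv φ) := by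
    refine (h2.fderiv (𝕜 := ℝ)).mono' ?_
    intro x hx
    apply subset_tsupport
    intro h0
    apply hx
    simp [vdiv, h0]
  have hi : Integrable (vdiv φ) := hc.integrable_of_hasCompactSupport hcs
  rw [setIntegral_sdiff hE hi.integrableOn hEΩ]
  have hΩ : ENNReal.ofReal (∫ x in Ω, vdiv φ x) ≤ relPerimeter Ω W :=
    le_iSup_of_le φ <| le_iSup_of_le h1 <| le_iSup_of_le h2 <| le_iSup_of_le h3 <|
      le_iSup_of_le h4 le_rfl
  have hts : tsupport (fun y => - φ y) = tsupport φ := by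
    unfold tsupport
    congr 1
    ext x
    simp
  have hE' : ENNReal.ofReal (- ∫ x in E, vdiv φ x) ≤ relPerimeter E W := by
    refine le_iSup_of_le (fun y => - φ y) <| le_iSup_of_le h1.neg <| le_iSup_of_le ?_ <|
      le_iSup_of_le (hts.le.trans h3) <|
      le_iSup_of_le (by simpa using h4) ?_
    · unfold HasCompactSupport; rw [hts]; exact h2
    · simp_rw [vdiv_neg']
      rw [integral_neg]
  calc ENNReal.ofReal ((∫ x in Ω, vdiv φ x) - ∫ x in E, vdiv φ x)
      ≤ _ := by rw [sub_eq_neg_add]; exact ENNReal.ofReal_add_le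
    _ ≤ _ := add_le_add hE' hΩ

/-- For `n ≥ 2` there is `C₁(n) > 0` such that for every bounded set of finite
perimeter `Ω ⊆ ℝⁿ`, every set of finite perimeter `E ⋐ Ω`, every `x`, and Lebesgue-a.e. `r > 0`
with `1/3 < |(Ω \ E) ∩ B_r(x)| / (ω_n rⁿ) < 1/2`, one has
`r^{n-1} ≤ C₁(n) (P(E; B_r(x)) + P(Ω; B_r(x)))`. -/
theorem relative_isoperimetric_lower_bound (n : ℕ) (hn : 2 ≤ n) :
    ∃ C : ℝ≥0, 0 < C ∧
      ∀ Ω E : Set (EuclideanSpace ℝ (Fin n)),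
        Bornology.IsBounded Ω → MeasurableSet Ω → perimeter Ω ≠ ⊤ →
        MeasurableSet E → perimeter E ≠ ⊤ → CpctContained E Ω →
        ∀ x : EuclideanSpace ℝ (Fin n),
        ∀ᵐ r ∂(volume.restrict (Set.Ioi (0 : ℝ))),
          (unitBallVol n * ENNReal.ofReal (r ^ n) / 3 < volume ((Ω \ E) ∩ ball x r) ∧
            volume ((Ω \ E) ∩ ball x r) < unitBallVol n * ENNReal.ofReal (r ^ n) / 2) →
          ENNReal.ofReal (r ^ (n - 1)) ≤
            (C : ℝ≥0∞) * (relPerimeter E (ball x r) + relPerimeter Ω (ball x r)) := by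
  set ω := unitBallVol n with hω
  have hωpos : 0 < ω.toReal :=
    ENNReal.toReal_pos (measure_ball_pos _ _ one_pos).ne' measure_ball_lt_top.ne
  have hωfin : ω ≠ ⊤ := measure_ball_lt_top.ne
  have hCpos : 0 < 12 * 2 ^ n / ω.toReal := by positivity
  refine ⟨⟨12 * 2 ^ n / ω.toReal, hCpos.le⟩, hCpos, ?_⟩
  intro Ω E hΩb hΩm _ hEm _ hEΩ x
  rw [ae_restrict_iff' measurableSet_Ioi]
  refine ae_of_all _ fun r hr => ?_
  rintro ⟨hlo, hhi⟩
  have hr : 0 < r := hr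
  have : Nonempty (Fin n) := ⟨⟨0, by omega⟩⟩
  have hsub : E ⊆ Ω := subset_closure.trans hEΩ.2
  have hPle := relPerimeter_diff_le Ω E (ball x r) hEm hsub
  refine le_trans ?_ (mul_le_mul_right hPle _)
  set F := Ω \ E with hF
  have hFm : MeasurableSet F := hΩm.diff hEm
  have hFfin : volume F ≠ ⊤ := measure_ne_top_of_subset sdiff_subset hΩb.measure_lt_top.ne
  by_cases hP : relPerimeter F (ball x r) = ⊤
  · rw [hP, ENNReal.mul_top]
    · exact le_top
    · exact ENNReal.coe_ne_zero.2 (ne_of_gt hCpos)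
  have hpo := poincare_set F hFm hFfin x r hP
  have hvol : ∀ (y : EuclideanSpace ℝ (Fin n)) (s : ℝ), 0 < s →
      (volume (ball y s)).toReal = s ^ n * ω.toReal := by
    intro y s hs
    rw [Measure.addHaar_ball _ _ hs.le, ENNReal.toReal_mul, ENNReal.toReal_ofReal (by positivity),
      finrank_euclideanSpace_fin]
    rfl
  set p := (relPerimeter F (ball x r)).toReal with hp
  set a := (volume (F ∩ ball x r)).toReal with ha
  set b := (volume (ball x r \ F)).toReal with hb
  have hafin : volume (F ∩ ball x r) ≠ ⊤ := measure_ne_top_of_subset inter_subset_left hFfin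
  have hbfin : volume (ball x r \ F) ≠ ⊤ :=
    measure_ne_top_of_subset sdiff_subset measure_ball_lt_top.ne
  have hab : a + b = r ^ n * ω.toReal := by
    rw [← hvol x r hr, ha, hb, ← ENNReal.toReal_add hafin hbfin, inter_comm,
      measure_inter_add_sdiff _ hFm]
  have ha1 : ω.toReal * r ^ n / 3 ≤ a := by
    have := ENNReal.toReal_mono hafin hlo.le
    rw [ENNReal.toReal_div, ENNReal.toReal_mul, ENNReal.toReal_ofReal (by positivity)] at this
    simpa using this
  have ha2 : a ≤ ω.toReal * r ^ n / 2 := by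
    have := ENNReal.toReal_mono (by finiteness) hhi.le
    rw [ENNReal.toReal_div, ENNReal.toReal_mul, ENNReal.toReal_ofReal (by positivity)] at this
    simpa using this
  have hmain : a * b ≤ 2 * r * p * ((2 * r) ^ n * ω.toReal) := by
    have hfin : volume (ball (0 : EuclideanSpace ℝ (Fin n)) (2 * r)) ≠ ⊤ := measure_ball_lt_top.ne
    have := ENNReal.toReal_mono (ENNReal.mul_ne_top
      (ENNReal.mul_ne_top ENNReal.ofReal_ne_top hP) hfin) hpo
    rwa [ENNReal.toReal_mul, ENNReal.toReal_mul, ENNReal.toReal_mul,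
      ENNReal.toReal_ofReal (by positivity), hvol 0 (2 * r) (by positivity)] at this
  have hlow : (ω.toReal * r ^ n / 3) * (ω.toReal * r ^ n / 2) ≤ a * b := by
    apply mul_le_mul ha1 (by linarith) (by positivity) ENNReal.toReal_nonneg
  have hfinal : r ^ (n - 1) ≤ 12 * 2 ^ n / ω.toReal * p := by
    obtain ⟨m, rfl⟩ : ∃ m, n = m + 1 := ⟨n - 1, by omega⟩
    simp only [Nat.add_sub_cancel]
    have h1 := hlow.trans hmain
    have hk : 0 < ω.toReal * r ^ (m + 2) := by positivity
    rw [div_mul_eq_mul_div, le_div_iff₀ hωpos]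
    refine le_of_mul_le_mul_left ?_ hk
    rw [mul_pow] at h1
    have e1 : ω.toReal * r ^ (m + 2) * (r ^ m * ω.toReal) =
      6 * (ω.toReal * r ^ (m + 1) / 3 * (ω.toReal * r ^ (m + 1) / 2)) := by ring
    have e2 : ω.toReal * r ^ (m + 2) * (12 * 2 ^ (m + 1) * p) =
      6 * (2 * r * p * (2 ^ (m + 1) * r ^ (m + 1) * ω.toReal)) := by ring
    linarith
  rw [← ENNReal.ofReal_toReal hP, ← hp]
  refine (ENNReal.ofReal_le_ofReal hfinal).trans ?_
  rw [ENNReal.ofReal_mul hCpos.le]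
  refine mul_le_mul_left (le_of_eq ?_) _
  rw [ENNReal.ofReal, Real.toNNReal_of_nonneg hCpos.le]
  rfl
end
end
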